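/- arXiv:2508.09739 — 2 statements merged into one kernel-verified Lean document; each statement's English description precedes it below -/
import Mathlib

section
/- Let F be a field of characteristic different from 2, and let x, y ∈ F^× be such that the extension M = F(√x, √y) obtained by adjoining square roots of x and y has degree 4 over F. Let A be a central simple F-algebra whose Brauer class is 2-torsion (A ⊗_F A is Brauer-equivalent to F) and which is split by M (A ⊗_F M is isomorphic to a matrix algebra over M). Then there exist u, v ∈ F^× such that A is Brauer-equivalent to the tensor product of quaternion algebras (u,y)_F ⊗_F (x,v)_F. -/
open scoped TensorProduct Quaternion

/-- Two finite-dimensional `F`-algebras are Brauer-equivalent if they become isomorphic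
after passing to matrix algebras: `Mat_n(A) ≅ Mat_m(B)` for some positive `n`, `m`. -/
def BrauerEquivalent (F A B : Type) [Field F] [Ring A] [Ring B]
    [Algebra F A] [Algebra F B] : Prop :=
  ∃ n m : ℕ, n ≠ 0 ∧ m ≠ 0 ∧
    Nonempty (Matrix (Fin n) (Fin n) A ≃ₐ[F] Matrix (Fin m) (Fin m) B)

section Biquadratic

open Polynomial

theorem isGalois_of_biquadratic {F M : Type*} [Field F] [Field M] [Algebra F M]
    (hchar : (2 : F) ≠ 0) {x y : F} (hx : x ≠ 0) (hy : y ≠ 0) {s t : M}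
    (hs : s ^ 2 = algebraMap F M x) (ht : t ^ 2 = algebraMap F M y)
    (hgen : Algebra.adjoin F ({s, t} : Set M) = ⊤) (hdeg : Module.finrank F M = 4) :
    IsGalois F M := by
  have : FiniteDimensional F M := Module.finite_of_finrank_pos (by omega)
  have hxy : x ≠ y := by
    rintro rfl
    have hmem : t ∈ Algebra.adjoin F {s} := by
      have hs' : s ∈ Algebra.adjoin F {s} := Algebra.self_mem_adjoin_singleton F s
      rcases sq_eq_sq_iff_eq_or_eq_neg.mp (hs.trans ht.symm) with h | h
      · rwa [← h]
      · rw [h, neg_mem_iff] at hs'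
        rwa [h]
    have htop : Algebra.adjoin F {s} = (⊤ : Subalgebra F M) := by
      rw [eq_top_iff, ← hgen, Algebra.adjoin_le_iff]
      rintro z (rfl | rfl)
      · exact Algebra.self_mem_adjoin_singleton F z
      · exact hmem
    have hint : IsIntegral F s := IsIntegral.of_finite F s
    have h1 := IntermediateField.adjoin.finrank hint
    have h2 : IntermediateField.adjoin F {s} = ⊤ := by
      rw [eq_top_iff]
      intro z _
      exact IntermediateField.algebra_adjoin_le_adjoin F {s} (htop ▸ Algebra.mem_top)
    rw [h2, IntermediateField.finrank_top', hdeg] at h1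
    have h3 : (minpoly F s).natDegree ≤ (X ^ 2 - C x : F[X]).natDegree :=
      natDegree_le_of_dvd (minpoly.dvd F s (by simp [hs]))
        (X_pow_sub_C_ne_zero two_pos x)
    rw [natDegree_X_pow_sub_C] at h3
    omega
  have hsep : ((X ^ 2 - C x) * (X ^ 2 - C y) : F[X]).Separable := by
    refine (separable_X_pow_sub_C x (by exact_mod_cast hchar) hx).mul
      (separable_X_pow_sub_C y (by exact_mod_cast hchar) hy) ⟨C (y - x)⁻¹, -C (y - x)⁻¹, ?_⟩
    have : (C (y - x)⁻¹ * C (y - x) : F[X]) = 1 := by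
      rw [← C_mul, inv_mul_cancel₀ (sub_ne_zero.mpr hxy.symm), C_1]
    rw [← this, C_sub]
    ring
  have hfac : ((X ^ 2 - C x) * (X ^ 2 - C y) : F[X]).map (algebraMap F M) =
      ((X - C s) * (X - C (-s))) * ((X - C t) * (X - C (-t))) := by
    simp only [Polynomial.map_mul, Polynomial.map_sub, Polynomial.map_pow, map_X, map_C, ← hs,
      ← ht, map_pow, map_neg]
    ring
  have : ((X ^ 2 - C x) * (X ^ 2 - C y) : F[X]).IsSplittingField F M := by
    refine ⟨?_, ?_⟩
    · rw [hfac]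
      exact ((Splits.X_sub_C _).mul (Splits.X_sub_C _)).mul
        ((Splits.X_sub_C _).mul (Splits.X_sub_C _))
    · rw [eq_top_iff, ← hgen]
      refine Algebra.adjoin_mono ?_
      rintro z (rfl | rfl) <;> rw [mem_rootSet_of_ne hsep.ne_zero] <;> simp [*]
  exact IsGalois.of_separable_splitting_field hsep

theorem exists_biquadratic_aut {F M : Type*} [Field F] [Field M] [Algebra F M]
    (hchar : (2 : F) ≠ 0) {x y : F} (hx : x ≠ 0) (hy : y ≠ 0) {s t : M}
    (hs : s ^ 2 = algebraMap F M x) (ht : t ^ 2 = algebraMap F M y)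
    (hgen : Algebra.adjoin F ({s, t} : Set M) = ⊤) (hdeg : Module.finrank F M = 4) :
    ∃ σ τ : M ≃ₐ[F] M, σ s = -s ∧ σ t = t ∧ τ s = s ∧ τ t = -t ∧
      (∀ z, σ (σ z) = z) ∧ (∀ z, τ (τ z) = z) ∧ (∀ z, τ (σ z) = σ (τ z)) ∧
      ∀ z, σ z = z → τ z = z → ∃ r : F, algebraMap F M r = z := by
  have : FiniteDimensional F M := Module.finite_of_finrank_pos (by omega)
  have := isGalois_of_biquadratic hchar hx hy hs ht hgen hdeg
  have ext {g h : M ≃ₐ[F] M} (h1 : g s = h s) (h2 : g t = h t) : g = h := by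
    have : (g : M →ₐ[F] M) = h := AlgHom.ext_of_adjoin_eq_top hgen (by
      rintro z (rfl | rfl) <;> assumption)
    ext z
    exact DFunLike.congr_fun this z
  have sgn (g : M ≃ₐ[F] M) : (g s = s ∨ g s = -s) ∧ (g t = t ∨ g t = -t) := by
    constructor <;> apply sq_eq_sq_iff_eq_or_eq_neg.mp <;> rw [← map_pow] <;> simp [hs, ht]
  classical
  let f : (M ≃ₐ[F] M) → Bool × Bool := fun g => (decide (g s = s), decide (g t = t))
  have hf : Function.Injective f := by
    intro g h hgh
    simp only [f, Prod.mk.injEq, decide_eq_decide] at hgh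
    have := sgn g
    have := sgn h
    apply ext <;> grind
  have hcard : Nat.card (M ≃ₐ[F] M) = Nat.card (Bool × Bool) := by
    rw [IsGalois.card_aut_eq_finrank, hdeg]; simp
  have hbij := (Nat.bijective_iff_injective_and_card f).mpr ⟨hf, hcard⟩
  obtain ⟨σ, hσ⟩ := hbij.2 (false, true)
  obtain ⟨τ, hτ⟩ := hbij.2 (true, false)
  simp only [f, Prod.mk.injEq, decide_eq_true_eq, decide_eq_false_iff_not] at hσ hτ
  have hσs := (sgn σ).1.resolve_left hσ.1
  have hτt := (sgn τ).2.resolve_left hτ.2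
  refine ⟨σ, τ, hσs, hσ.2, hτ.1, hτt, ?_, ?_, ?_, ?_⟩
  · have : σ * σ = 1 := ext (by simp [hσs]) (by simp [hσ.2])
    exact fun z => DFunLike.congr_fun this z
  · have : τ * τ = 1 := ext (by simp [hτ.1]) (by simp [hτt])
    exact fun z => DFunLike.congr_fun this z
  · have : τ * σ = σ * τ := ext (by simp [hσs, hτ.1]) (by simp [hσ.2, hτt])
    exact fun z => DFunLike.congr_fun this z
  · intro z hz1 hz2
    have : z ∈ (⊥ : IntermediateField F M) := by
      rw [IsGalois.mem_bot_iff_fixed]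
      intro g
      rcases sgn g with ⟨h1 | h1, h2 | h2⟩
      · rw [ext (h := 1) h1 h2]; rfl
      · rw [ext (h := τ) (h1.trans hτ.1.symm) (h2.trans hτt.symm), hz2]
      · rw [ext (h := σ) (h1.trans hσs.symm) (h2.trans hσ.2.symm), hz1]
      · have hg : g = σ * τ := ext (by simp [h1, hτ.1, hσs]) (by simp [h2, hτt, hσ.2])
        rw [hg, AlgEquiv.mul_apply, hz2, hz1]
    exact IntermediateField.mem_bot.mp this

end Biquadratic

theorem Matrix.exists_unit_conj_of_algHom {n K : Type*} [Fintype n] [DecidableEq n] [Nonempty n]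
    [Field K] (f : Matrix n n K →ₐ[K] Matrix n n K) :
    ∃ U : (Matrix n n K)ˣ, ∀ X, f X * U = U * X := by
  have hinj : Function.Injective f := RingHom.injective (f : Matrix n n K →+* Matrix n n K)
  have hbij : Function.Bijective f :=
    ⟨hinj, LinearMap.surjective_of_injective (f := f.toLinearMap) hinj⟩
  let e : Matrix n n K ≃ₐ[K] Module.End K (n → K) := Matrix.toLinAlgEquiv'
  obtain ⟨T, hT⟩ :=
    ((e.symm.trans (AlgEquiv.ofBijective f hbij)).trans e).eq_linearEquivConjAlgEquiv
  refine ⟨Units.map (e.symm : Module.End K (n → K) →* Matrix n n K)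
    (LinearMap.GeneralLinearGroup.ofLinearEquiv T), fun X => ?_⟩
  apply e.injective
  have h := DFunLike.congr_fun hT (e X)
  simp only [AlgEquiv.trans_apply, AlgEquiv.symm_apply_apply, AlgEquiv.ofBijective_apply] at h
  rw [map_mul, map_mul, h]
  refine LinearMap.ext fun v => ?_
  simp [LinearEquiv.conjAlgEquiv_apply, LinearMap.GeneralLinearGroup.ofLinearEquiv]

theorem AlgEquiv.mapMatrix_smul' {F M n : Type*} [Field F] [Field M] [Algebra F M] [Fintype n]
    [DecidableEq n] (σ : M ≃ₐ[F] M) (z : M) (X : Matrix n n M) :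
    σ.mapMatrix (z • X) = σ z • σ.mapMatrix X := by
  ext i j
  simp

/-- An algebra homomorphism `φ` from `A` to matrices over an extension `M` and its
Galois twist by `σ` are conjugate whenever `φ` induces a splitting of `A` over `M`. -/
theorem exists_unit_twist {F M A : Type*} [Field F] [Field M] [Algebra F M] [Ring A] [Algebra F A]
    {n : Type*} [Fintype n] [DecidableEq n] [Nonempty n]
    (ψ : (M ⊗[F] A) ≃ₐ[M] Matrix n n M) (σ : M ≃ₐ[F] M) :
    ∃ P : (Matrix n n M)ˣ, ∀ a : A, P * σ.mapMatrix (ψ (1 ⊗ₜ a)) = ψ (1 ⊗ₜ a) * P := by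
  let φ : A →ₐ[F] Matrix n n M :=
    (ψ.toAlgHom.restrictScalars F).comp Algebra.TensorProduct.includeRight
  let χ : (M ⊗[F] A) →ₐ[M] Matrix n n M :=
    Algebra.TensorProduct.lift (Algebra.ofId M _) (σ.mapMatrix.toAlgHom.comp φ)
      fun z a => Algebra.commutes z _
  obtain ⟨U, hU⟩ := Matrix.exists_unit_conj_of_algHom (χ.comp ψ.symm.toAlgHom)
  refine ⟨U⁻¹, fun a => ?_⟩
  have h : σ.mapMatrix (ψ (1 ⊗ₜ a)) * U = U * ψ (1 ⊗ₜ a) := by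
    have h := hU (ψ (1 ⊗ₜ a))
    have hχ : (χ.comp ψ.symm.toAlgHom) (ψ (1 ⊗ₜ a)) = σ.mapMatrix (ψ (1 ⊗ₜ a)) := by
      change χ (ψ.symm (ψ (1 ⊗ₜ a))) = _
      rw [AlgEquiv.symm_apply_apply]
      exact (Algebra.TensorProduct.lift_tmul _ _ _ _ _).trans (by simp [φ])
    rwa [hχ] at h
  rw [Units.eq_mul_inv_iff_mul_eq, mul_assoc, h, Units.inv_mul_cancel_left]

theorem Matrix.eq_smul_one_of_commute_span {A M n : Type*} [Field M] [Fintype n] [DecidableEq n]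
    {φ : A → Matrix n n M} (hφ : Submodule.span M (Set.range φ) = ⊤) {X : Matrix n n M}
    (hX : ∀ a, φ a * X = X * φ a) : ∃ z : M, X = z • 1 := by
  have hc (Y : Matrix n n M) : Y * X = X * Y := by
    have hY : Y ∈ Submodule.span M (Set.range φ) := hφ ▸ Submodule.mem_top
    induction hY using Submodule.span_induction with
    | mem _ h => obtain ⟨a, rfl⟩ := h; exact hX a
    | zero => simp
    | add _ _ _ _ h1 h2 => rw [add_mul, mul_add, h1, h2]
    | smul z _ _ h => rw [smul_mul_assoc, mul_smul_comm, h]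
  obtain ⟨z, hz⟩ := Matrix.mem_range_scalar_of_commute_single (M := X) fun i j _ => hc _
  exact ⟨z, by rw [← hz, Matrix.scalar_apply, Matrix.smul_one_eq_diagonal]⟩

theorem span_range_splitting {F M A n : Type*} [Field F] [Field M] [Algebra F M] [Ring A]
    [Algebra F A] [Fintype n] [DecidableEq n] (ψ : (M ⊗[F] A) ≃ₐ[M] Matrix n n M) :
    Submodule.span M (Set.range fun a : A => ψ (1 ⊗ₜ a)) = ⊤ := by
  rw [eq_top_iff]
  intro X _
  obtain ⟨w, rfl⟩ := ψ.surjective X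
  induction w with
  | zero => simp
  | add u v hu hv =>
    rw [map_add]; exact add_mem (hu trivial) (hv trivial)
  | tmul z a =>
    have : ψ (z ⊗ₜ a) = z • ψ (1 ⊗ₜ a) := by
      rw [← map_smul, TensorProduct.smul_tmul', smul_eq_mul, mul_one]
    rw [this]
    exact Submodule.smul_mem _ _ (Submodule.subset_span ⟨a, rfl⟩)

/-- If `B` is Brauer-equivalent to `F`, then it contains an element of rank one. -/
theorem exists_rank_one {F B p q : Type*} [Field F] [Ring B] [Algebra F B]
    [Fintype p] [DecidableEq p] [Nonempty p] [Fintype q] [DecidableEq q]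
    (Θ : Matrix p p B ≃ₐ[F] Matrix q q F) [Nontrivial B] :
    ∃ e : B, e ≠ 0 ∧ ∀ b, ∃ r : F, e * b * e = r • e := by
  obtain ⟨k⟩ := ‹Nonempty p›
  set f := Θ (Matrix.single k k 1) with hf
  have hf0 : f ≠ 0 := by
    rw [hf, ne_eq, map_eq_zero_iff _ Θ.injective]
    intro h
    simpa using congr_fun₂ h k k
  obtain ⟨i, j, hij⟩ : ∃ i j, f i j ≠ 0 := by
    by_contra! h
    exact hf0 (Matrix.ext h)
  set g := f * Matrix.single j i 1 * f with hg
  have hg' : g = Matrix.vecMulVec (fun k => f k j) (f i) := by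
    ext a b
    simp [hg, Matrix.mul_apply, Matrix.single_apply, Matrix.vecMulVec_apply, ite_and]
  have hg0 : g ≠ 0 := by
    intro h
    have := congr_fun₂ h i j
    simp [hg', Matrix.vecMulVec_apply, hij] at this
  have hgg (Y : Matrix q q F) : ∃ r : F, g * Y * g = r • g := by
    rw [hg', Matrix.vecMulVec_mul, Matrix.vecMulVec_mul_vecMulVec]
    exact ⟨_, Matrix.vecMulVec_smul _ _ _⟩
  set G := Θ.symm g with hG
  have hGs : G = Matrix.single k k (G k k) := by
    have : G = Matrix.single k k 1 * Θ.symm (Matrix.single j i 1) * Matrix.single k k 1 := by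
      simp [hG, hg, hf]
    rw [this]
    simp
  refine ⟨G k k, fun h => ?_, fun b => ?_⟩
  · rw [h, Matrix.single_zero, hG, map_eq_zero_iff _ Θ.symm.injective] at hGs
    exact hg0 hGs
  · obtain ⟨r, hr⟩ := hgg (Θ (Matrix.single k k b))
    refine ⟨r, ?_⟩
    have := congr_arg Θ.symm hr
    rw [map_mul, map_mul, AlgEquiv.symm_apply_apply, map_smul, ← hG, hGs] at this
    simpa using congr_fun₂ this k k

/-- If `A ⊗ A` is split over `F` and `A` is split over `M`, then all the twisted conjugations
`X ↦ P σ(X) Pᵀ` attached to `A` have a common eigenvector. -/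
theorem exists_common_eigenvector {F M A n p q : Type*} [Field F] [Field M] [Algebra F M] [Ring A]
    [Algebra F A] [Nontrivial A] [Fintype n] [DecidableEq n] [Nonempty n]
    [Fintype p] [DecidableEq p] [Nonempty p] [Fintype q] [DecidableEq q]
    (ψ : (M ⊗[F] A) ≃ₐ[M] Matrix n n M)
    (Θ : Matrix p p (A ⊗[F] A) ≃ₐ[F] Matrix q q F) :
    ∃ w : Matrix n n M, w ≠ 0 ∧ ∀ (σ : M ≃ₐ[F] M) (P : Matrix n n M),
      (∀ a : A, P * σ.mapMatrix (ψ (1 ⊗ₜ a)) = ψ (1 ⊗ₜ a) * P) →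
      ∃ b : M, P * σ.mapMatrix w * P.transpose = b • w := by
  have hspan := span_range_splitting ψ
  let φ : A →ₐ[F] Matrix n n M :=
    (ψ.toAlgHom.restrictScalars F).comp Algebra.TensorProduct.includeRight
  have hφ (a : A) : φ a = ψ (1 ⊗ₜ a) := rfl
  simp only [← hφ] at hspan ⊢
  let L : Matrix n n M →ₐ[M] Module.End M (Matrix n n M) := Algebra.lmul M _
  let R : Matrix n n M →ₐ[M] Module.End M (Matrix n n M) :=
    ((Matrix.transposeLinearEquiv n n M M).conjAlgEquiv M).toAlgHom.comp L
  have hL (N X : Matrix n n M) : L N X = N * X := rfl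
  have hR (N X : Matrix n n M) : R N X = X * N.transpose := by
    change (N * X.transpose).transpose = _
    rw [Matrix.transpose_mul, Matrix.transpose_transpose]
  let Φ : A ⊗[F] A →ₐ[F] Module.End M (Matrix n n M) :=
    Algebra.TensorProduct.lift ((L.restrictScalars F).comp φ) ((R.restrictScalars F).comp φ)
      fun a b => LinearMap.ext fun X => by
        simp [hL, hR, Matrix.mul_assoc]
  have hΦ (a b : A) : Φ (a ⊗ₜ b) = L (φ a) * R (φ b) := Algebra.TensorProduct.lift_tmul _ _ _ _ _
  have : Nontrivial (A ⊗[F] A) := inferInstance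
  have hinj : Function.Injective Φ := by
    have : Nonempty q := by
      by_contra h
      rw [not_nonempty_iff] at h
      exact not_subsingleton (Matrix p p (A ⊗[F] A)) Θ.toEquiv.subsingleton
    have h := RingHom.injective ((Φ.mapMatrix.comp Θ.symm.toAlgHom : _ →ₐ[F] _) :
      Matrix q q F →+* Matrix p p (Module.End M (Matrix n n M)))
    intro u v huv
    obtain ⟨k⟩ := ‹Nonempty p›
    have h' : Θ (Matrix.single k k u) = Θ (Matrix.single k k v) := by
      apply h
      ext1 i j
      simp [Matrix.single_apply, apply_ite Φ, huv]
    simpa using congr_fun₂ (Θ.injective h') k k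
  obtain ⟨e, he0, he⟩ := exists_rank_one Θ
  obtain ⟨X₀, hX₀⟩ : ∃ X, Φ e X ≠ 0 := by
    by_contra! h
    exact he0 (hinj (by rw [map_zero]; exact LinearMap.ext h))
  have key (N N' : Matrix n n M) : ∃ z : M, Φ e * (L N * R N') * Φ e = z • Φ e := by
    have hN : N ∈ Submodule.span M (Set.range φ) := hspan ▸ Submodule.mem_top
    have hN' : N' ∈ Submodule.span M (Set.range φ) := hspan ▸ Submodule.mem_top
    induction hN using Submodule.span_induction with
    | zero => exact ⟨0, by simp⟩
    | add _ _ _ _ h1 h2 =>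
      obtain ⟨z1, h1⟩ := h1
      obtain ⟨z2, h2⟩ := h2
      exact ⟨z1 + z2, by rw [map_add, add_mul, mul_add, add_mul, h1, h2, add_smul]⟩
    | smul c _ _ h =>
      obtain ⟨z, h⟩ := h
      exact ⟨c * z, by rw [map_smul, smul_mul_assoc, mul_smul_comm, smul_mul_assoc, h, mul_smul]⟩
    | mem _ h =>
      obtain ⟨a, rfl⟩ := h
      induction hN' using Submodule.span_induction with
      | zero => exact ⟨0, by simp⟩
      | add _ _ _ _ h1 h2 =>
        obtain ⟨z1, h1⟩ := h1
        obtain ⟨z2, h2⟩ := h2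
        exact ⟨z1 + z2, by rw [map_add, mul_add, mul_add, add_mul, h1, h2, add_smul]⟩
      | smul c _ _ h =>
        obtain ⟨z, h⟩ := h
        exact ⟨c * z, by rw [map_smul, mul_smul_comm, mul_smul_comm, smul_mul_assoc, h, mul_smul]⟩
      | mem _ h =>
        obtain ⟨b, rfl⟩ := h
        obtain ⟨r, hr⟩ := he (a ⊗ₜ b)
        refine ⟨algebraMap F M r, ?_⟩
        rw [← hΦ, ← map_mul, ← map_mul, hr, map_smul, algebraMap_smul]
  set w := Φ e X₀ with hw
  obtain ⟨i, j, hij⟩ : ∃ i j, w i j ≠ 0 := by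
    by_contra! h
    exact hX₀ (Matrix.ext h)
  have line (X : Matrix n n M) : ∃ z : M, Φ e X = z • w := by
    induction X using Matrix.induction_on' with
    | h_zero => exact ⟨0, by simp⟩
    | h_add _ _ h1 h2 =>
      obtain ⟨z1, h1⟩ := h1
      obtain ⟨z2, h2⟩ := h2
      exact ⟨z1 + z2, by rw [map_add, h1, h2, add_smul]⟩
    | h_std_basis k l c =>
      obtain ⟨z, hz⟩ := key (Matrix.single k i (c / w i j)) (Matrix.single l j 1)
      refine ⟨z, ?_⟩
      have h := LinearMap.congr_fun hz X₀
      simp only [Module.End.mul_apply, LinearMap.smul_apply, hL, hR, ← hw] at h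
      rw [← h]
      congr 1
      rw [Matrix.transpose_single, ← mul_assoc]
      simp [hij]
  refine ⟨w, hX₀, fun σ P hP => ?_⟩
  have comm (b : A ⊗[F] A) (X : Matrix n n M) :
      P * σ.mapMatrix (Φ b X) * P.transpose = Φ b (P * σ.mapMatrix X * P.transpose) := by
    induction b with
    | zero => simp
    | add u v hu hv =>
      rw [map_add, LinearMap.add_apply, LinearMap.add_apply, ← hu, ← hv, map_add, mul_add, add_mul]
    | tmul a b =>
      have h1 : (σ.mapMatrix (φ b)).transpose * P.transpose = P.transpose * (φ b).transpose := by
        rw [← Matrix.transpose_mul, ← Matrix.transpose_mul, hP]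
      simp only [hΦ, Module.End.mul_apply, hL, hR, map_mul]
      have h2 : σ.mapMatrix (φ b).transpose = (σ.mapMatrix (φ b)).transpose := rfl
      rw [h2]
      simp only [mul_assoc]
      rw [h1, ← mul_assoc, hP]
      simp only [mul_assoc]
  rw [hw, comm]
  exact line _

section GaloisRelations

variable {F M : Type*} [Field F] [Field M] [Algebra F M]

/-- Hilbert's Theorem 90 for an involution that negates some nonzero element. -/
theorem exists_apply_eq_mul_of_norm_one {σ : M ≃ₐ[F] M} (hσ : ∀ z, σ (σ z) = z) {s : M}
    (hs0 : s ≠ 0) (hs : σ s = -s) {r : M} (hr : r * σ r = 1) :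
    ∃ k : M, k ≠ 0 ∧ σ k = k * r := by
  by_cases h : r = -1
  · exact ⟨s, hs0, by rw [hs, h]; ring⟩
  · refine ⟨1 + σ r, fun h0 => h ?_, ?_⟩
    · rw [← hσ r, eq_neg_of_add_eq_zero_right h0]; simp
    · rw [map_add, map_one, hσ]; linear_combination -hr

theorem exists_norm_eq_of_sq_coboundary {σ τ : M ≃ₐ[F] M} (hσ : ∀ z, σ (σ z) = z)
    (hτ : ∀ z, τ (τ z) = z) (hστ : ∀ z, τ (σ z) = σ (τ z)) {s : M} (hs0 : s ≠ 0)
    (hs : σ s = -s) {a b c d e : M} (hd0 : d ≠ 0)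
    (hd : σ d = d) (hc : σ c = e * τ e * c) (hde : e * σ e * τ d = d)
    (hb : b * τ b = c ^ 2) (ha : a * σ a = d ^ 2) (hab : e ^ 2 * τ a * b = σ b * a) :
    ∃ g : M, σ g = g ∧ g * τ g = c * σ c := by
  obtain ⟨k, hk0, hk⟩ := exists_apply_eq_mul_of_norm_one hσ hs0 hs (r := a / d) (by
    rw [map_div₀, hd, div_mul_div_comm, ha, sq, div_self (mul_ne_zero hd0 hd0)])
  have ha0 : a ≠ 0 := by
    rintro rfl
    rw [zero_mul, eq_comm, sq_eq_zero_iff] at ha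
    exact hd0 ha
  have hτk : τ k ≠ 0 := (map_ne_zero τ).mpr hk0
  have hτa : τ a ≠ 0 := (map_ne_zero τ).mpr ha0
  have hτd : τ d ≠ 0 := (map_ne_zero τ).mpr hd0
  refine ⟨e * b * k / τ k, ?_, ?_⟩
  · rw [map_div₀, map_mul, map_mul, ← hστ, hk, map_mul, map_div₀, div_eq_div_iff
      (by positivity) hτk]
    field_simp
    linear_combination e * b * τ a * hde - σ e * τ d * hab
  · rw [map_div₀, map_mul, map_mul, hτ, hc]
    field_simp
    linear_combination e * τ e * hb

theorem exists_norm_mul_eq_algebraMap (h2 : (2 : M) ≠ 0) {σ τ : M ≃ₐ[F] M}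
    (hσ : ∀ z, σ (σ z) = z)
    (hτ : ∀ z, τ (τ z) = z) (hστ : ∀ z, τ (σ z) = σ (τ z))
    (hfix : ∀ z, σ z = z → τ z = z → ∃ r : F, algebraMap F M r = z)
    {c g : M} (hc0 : c ≠ 0) (hc : τ c = c) (hg : σ g = g) (hcg : g * τ g = c * σ c) :
    ∃ (h : M) (u : F), u ≠ 0 ∧ h * τ h * c = algebraMap F M u := by
  wlog hne : c + σ c + (g + τ g) ≠ 0 generalizing g
  · refine this (g := -g) (by simp [hg]) (by simpa using hcg) fun h0 => ?_
    push Not at hne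
    rw [map_neg] at h0
    have h3 : 2 * (c + σ c) = 0 := by linear_combination h0 + hne
    have h4 : σ c = -c :=
      eq_neg_of_add_eq_zero_right ((mul_eq_zero.mp h3).resolve_left h2)
    have h5 : τ g = -g := by linear_combination hne - h4
    rw [h4, h5] at hcg
    have h6 : σ c = c := by
      rcases sq_eq_sq_iff_eq_or_eq_neg.mp (show c ^ 2 = g ^ 2 by linear_combination hcg)
        with rfl | rfl
      · exact hg
      · rw [map_neg, hg]
    exact mul_ne_zero h2 hc0 (by linear_combination h4 - h6)
  obtain ⟨u, hu⟩ := hfix (c + σ c + (g + τ g)) (by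
    simp only [map_add, hσ, hg, ← hστ]; ring) (by
    simp only [map_add, hτ, hστ, hc]; ring)
  refine ⟨(c + g) / c, u, ?_, ?_⟩
  · rintro rfl
    exact hne (by rw [← hu, map_zero])
  · rw [hu, map_div₀, map_add, hc]
    field_simp
    linear_combination hcg

variable {n : Type*} [Fintype n] [DecidableEq n]

theorem Matrix.eq_smul_of_twist_span {A : Type*} {φ : A → Matrix n n M}
    (hφ : Submodule.span M (Set.range φ) = ⊤) {g : A → Matrix n n M} {X Y : Matrix n n M}
    (hY : IsUnit Y) (hXg : ∀ a, X * g a = φ a * X) (hYg : ∀ a, Y * g a = φ a * Y) :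
    ∃ z : M, X = z • Y := by
  obtain ⟨U, rfl⟩ := hY
  obtain ⟨z, hz⟩ := Matrix.eq_smul_one_of_commute_span hφ
      (X := X * (↑U⁻¹ : Matrix n n M)) fun a => by
    rw [← mul_assoc, ← hXg, mul_assoc, mul_assoc]
    congr 1
    rw [Units.eq_inv_mul_iff_mul_eq, ← mul_assoc, hYg, mul_assoc, Units.mul_inv, mul_one]
  refine ⟨z, ?_⟩
  rw [Units.mul_inv_eq_iff_eq_mul] at hz
  rw [hz, smul_mul_assoc, one_mul]

theorem fixed_of_mul_twist_eq_smul_one [Nonempty n] {τ : M ≃ₐ[F] M} (hτ : ∀ z, τ (τ z) = z)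
    {P : Matrix n n M} (hP : IsUnit P) {c : M} (hc : P * τ.mapMatrix P = c • 1) : τ c = c := by
  have hττ (X : Matrix n n M) : τ.mapMatrix (τ.mapMatrix X) = X := by ext; simp [hτ]
  have h := congr_arg τ.mapMatrix hc
  rw [map_mul, hττ, AlgEquiv.mapMatrix_smul', map_one] at h
  have h1 : P * (τ.mapMatrix P * P) = P * τ.mapMatrix P * P := (mul_assoc _ _ _).symm
  rw [h, hc, mul_smul_comm, smul_mul_assoc, one_mul, mul_one] at h1
  exact smul_left_injective M hP.ne_zero h1

theorem twist_relations [Nonempty n] {σ τ : M ≃ₐ[F] M} (hσ : ∀ z, σ (σ z) = z)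
    (hτ : ∀ z, τ (τ z) = z) (hστ : ∀ z, τ (σ z) = σ (τ z)) {P Q : Matrix n n M}
    (hP : IsUnit P) (hQ : IsUnit Q) {c d e : M} (hc : P * τ.mapMatrix P = c • 1)
    (hd : Q * σ.mapMatrix Q = d • 1) (he : Q * σ.mapMatrix P = e • (P * τ.mapMatrix Q)) :
    σ c = e * τ e * c ∧ e * σ e * τ d = d := by
  have hσσ (X : Matrix n n M) : σ.mapMatrix (σ.mapMatrix X) = X := by ext; simp [hσ]
  have hττ (X : Matrix n n M) : τ.mapMatrix (τ.mapMatrix X) = X := by ext; simp [hτ]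
  have hcomm (X : Matrix n n M) : τ.mapMatrix (σ.mapMatrix X) = σ.mapMatrix (τ.mapMatrix X) := by
    ext; simp [hστ]
  constructor
  · apply smul_left_injective M hQ.ne_zero
    change σ c • Q = (e * τ e * c) • Q
    calc σ c • Q = Q * σ.mapMatrix (P * τ.mapMatrix P) := by
          rw [hc, AlgEquiv.mapMatrix_smul', map_one, mul_smul_comm, mul_one]
      _ = e • (P * τ.mapMatrix (Q * σ.mapMatrix P)) := by
          rw [map_mul, map_mul τ.mapMatrix Q, hcomm, ← mul_assoc, he, smul_mul_assoc, mul_assoc]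
      _ = (e * τ e * c) • Q := by
          rw [he, AlgEquiv.mapMatrix_smul', map_mul, hττ, mul_smul_comm, ← mul_assoc, hc,
            smul_mul_assoc, one_mul, smul_smul, smul_smul, mul_assoc]
  · apply smul_left_injective M hP.ne_zero
    change (e * σ e * τ d) • P = d • P
    calc (e * σ e * τ d) • P = (e * σ e) • (P * τ.mapMatrix (Q * σ.mapMatrix Q)) := by
          rw [hd, AlgEquiv.mapMatrix_smul', map_one, mul_smul_comm, mul_one, smul_smul]
      _ = Q * σ.mapMatrix (Q * σ.mapMatrix P) := by
          rw [he, AlgEquiv.mapMatrix_smul', mul_smul_comm, map_mul σ.mapMatrix, ← mul_assoc, he,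
            smul_mul_assoc, smul_smul, map_mul τ.mapMatrix, hcomm, mul_comm e, mul_assoc]
      _ = d • P := by
          rw [map_mul, hσσ, ← mul_assoc, hd, smul_mul_assoc, one_mul]

end GaloisRelations

/-- The twisting matrices of a 2-torsion algebra split by a biquadratic extension can be chosen
so that their twisted squares are scalars from the base field and they commute in the twisted
sense. -/
theorem exists_normalized_twists {F M A n p q : Type*} [Field F] [Field M] [Algebra F M] [Ring A]
    [Algebra F A] [Nontrivial A] [Fintype n] [DecidableEq n] [Nonempty n]
    [Fintype p] [DecidableEq p] [Nonempty p] [Fintype q] [DecidableEq q]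
    (ψ : (M ⊗[F] A) ≃ₐ[M] Matrix n n M)
    (Θ : Matrix p p (A ⊗[F] A) ≃ₐ[F] Matrix q q F) (h2 : (2 : M) ≠ 0) {σ τ : M ≃ₐ[F] M}
    (hσ : ∀ z, σ (σ z) = z)
    (hτ : ∀ z, τ (τ z) = z) (hστ : ∀ z, τ (σ z) = σ (τ z))
    (hfix : ∀ z, σ z = z → τ z = z → ∃ r : F, algebraMap F M r = z)
    {s t : M} (hs0 : s ≠ 0) (ht0 : t ≠ 0) (hs : σ s = -s) (ht : τ t = -t) :
    ∃ (P Q : Matrix n n M) (u v : F), u ≠ 0 ∧ v ≠ 0 ∧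
      (∀ a : A, P * τ.mapMatrix (ψ (1 ⊗ₜ a)) = ψ (1 ⊗ₜ a) * P) ∧
      (∀ a : A, Q * σ.mapMatrix (ψ (1 ⊗ₜ a)) = ψ (1 ⊗ₜ a) * Q) ∧
      P * τ.mapMatrix P = algebraMap F M u • 1 ∧ Q * σ.mapMatrix Q = algebraMap F M v • 1 ∧
      Q * σ.mapMatrix P = P * τ.mapMatrix Q := by
  have hspan := span_range_splitting ψ
  have hσσ (X : Matrix n n M) : σ.mapMatrix (σ.mapMatrix X) = X := by ext; simp [hσ]
  have hττ (X : Matrix n n M) : τ.mapMatrix (τ.mapMatrix X) = X := by ext; simp [hτ]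
  have hcomm (X : Matrix n n M) : τ.mapMatrix (σ.mapMatrix X) = σ.mapMatrix (τ.mapMatrix X) := by
    ext; simp [hστ]
  have twist_mul {θ ρ : M ≃ₐ[F] M} {X Y : Matrix n n M}
      (hX : ∀ a : A, X * θ.mapMatrix (ψ (1 ⊗ₜ a)) = ψ (1 ⊗ₜ a) * X)
      (hY : ∀ a : A, Y * ρ.mapMatrix (ψ (1 ⊗ₜ a)) = ψ (1 ⊗ₜ a) * Y) (a : A) :
      (X * θ.mapMatrix Y) * θ.mapMatrix (ρ.mapMatrix (ψ (1 ⊗ₜ a))) =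
        ψ (1 ⊗ₜ a) * (X * θ.mapMatrix Y) := by
    rw [mul_assoc, ← map_mul, hY, map_mul, ← mul_assoc, hX, mul_assoc]
  have twist_sq {θ : M ≃ₐ[F] M} (hθ : ∀ X : Matrix n n M, θ.mapMatrix (θ.mapMatrix X) = X)
      {X : Matrix n n M} (hXu : IsUnit X)
      (hX : ∀ a : A, X * θ.mapMatrix (ψ (1 ⊗ₜ a)) = ψ (1 ⊗ₜ a) * X) :
      ∃ c : M, c ≠ 0 ∧ X * θ.mapMatrix X = c • 1 := by
    obtain ⟨c, hc⟩ := Matrix.eq_smul_one_of_commute_span hspan (X := X * θ.mapMatrix X) fun a => by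
      rw [← twist_mul hX hX, hθ]
    refine ⟨c, ?_, hc⟩
    rintro rfl
    rw [zero_smul] at hc
    exact (hXu.mul (hXu.map θ.mapMatrix)).ne_zero hc
  have twist_comm {X Y : Matrix n n M} (hXu : IsUnit X) (hYu : IsUnit Y)
      (hX : ∀ a : A, X * τ.mapMatrix (ψ (1 ⊗ₜ a)) = ψ (1 ⊗ₜ a) * X)
      (hY : ∀ a : A, Y * σ.mapMatrix (ψ (1 ⊗ₜ a)) = ψ (1 ⊗ₜ a) * Y) :
      ∃ e : M, Y * σ.mapMatrix X = e • (X * τ.mapMatrix Y) := by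
    refine Matrix.eq_smul_of_twist_span hspan (hXu.mul (hYu.map τ.mapMatrix)) (twist_mul hY hX)
      fun a => ?_
    rw [← hcomm]
    exact twist_mul hX hY a
  have twist_smul {θ : M ≃ₐ[F] M} {X : Matrix n n M} (z : M)
      (hX : ∀ a : A, X * θ.mapMatrix (ψ (1 ⊗ₜ a)) = ψ (1 ⊗ₜ a) * X) (a : A) :
      (z • X) * θ.mapMatrix (ψ (1 ⊗ₜ a)) = ψ (1 ⊗ₜ a) * (z • X) := by
    rw [smul_mul_assoc, hX, mul_smul_comm]
  have unit_smul {X : Matrix n n M} {z : M} (hz : z ≠ 0) (hX : IsUnit X) : IsUnit (z • X) := by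
    simpa [Units.smul_def] using hX.smul (Units.mk0 z hz)
  obtain ⟨P, hP⟩ := exists_unit_twist ψ τ
  obtain ⟨Q, hQ⟩ := exists_unit_twist ψ σ
  obtain ⟨c, hc0, hc⟩ := twist_sq hττ P.isUnit hP
  obtain ⟨d, hd0, hd⟩ := twist_sq hσσ Q.isUnit hQ
  obtain ⟨e, he⟩ := twist_comm P.isUnit Q.isUnit hP hQ
  have hτc := fixed_of_mul_twist_eq_smul_one hτ P.isUnit hc
  have hσd := fixed_of_mul_twist_eq_smul_one hσ Q.isUnit hd
  obtain ⟨hσc, hde⟩ := twist_relations hσ hτ hστ P.isUnit Q.isUnit hc hd he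
  obtain ⟨w, hw0, hw⟩ := exists_common_eigenvector ψ Θ
  obtain ⟨b, hb⟩ := hw τ P hP
  obtain ⟨a, ha⟩ := hw σ Q hQ
  have conj_comp (θ ρ : M ≃ₐ[F] M) (X Y : Matrix n n M) (z z' : M)
      (hX : X * θ.mapMatrix w * X.transpose = z • w)
      (hY : Y * ρ.mapMatrix w * Y.transpose = z' • w) :
      (X * θ.mapMatrix Y) * θ.mapMatrix (ρ.mapMatrix w) * (X * θ.mapMatrix Y).transpose =
        (θ z' * z) • w := by
    have h : θ.mapMatrix Y.transpose = (θ.mapMatrix Y).transpose := rfl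
    calc _ = X * θ.mapMatrix (Y * ρ.mapMatrix w * Y.transpose) * X.transpose := by
          rw [map_mul, map_mul, h, Matrix.transpose_mul]
          simp only [mul_assoc]
      _ = _ := by
          rw [hY, AlgEquiv.mapMatrix_smul', mul_smul_comm, smul_mul_assoc, hX, smul_smul]
  have hw_inj := smul_left_injective M hw0
  have hb' : b * τ b = c ^ 2 := by
    have h := conj_comp τ τ P P b b hb hb
    rw [hττ, hc, Matrix.transpose_smul, Matrix.transpose_one, smul_mul_assoc, one_mul,
      smul_mul_assoc, mul_smul_comm, mul_one, smul_smul] at h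
    linear_combination -(hw_inj h)
  have ha' : a * σ a = d ^ 2 := by
    have h := conj_comp σ σ Q Q a a ha ha
    rw [hσσ, hd, Matrix.transpose_smul, Matrix.transpose_one, smul_mul_assoc, one_mul,
      smul_mul_assoc, mul_smul_comm, mul_one, smul_smul] at h
    linear_combination -(hw_inj h)
  have hab : e ^ 2 * τ a * b = σ b * a := by
    have h := conj_comp σ τ Q P a b ha hb
    have h' := conj_comp τ σ P Q b a hb ha
    rw [he, Matrix.transpose_smul, smul_mul_assoc, smul_mul_assoc, mul_smul_comm, ← hcomm, h',
      smul_smul, smul_smul] at h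
    linear_combination hw_inj h
  obtain ⟨g, hg, hcg⟩ :=
    exists_norm_eq_of_sq_coboundary hσ hτ hστ hs0 hs hd0 hσd hσc hde hb' ha' hab
  obtain ⟨h, u, hu0, hu⟩ :=
    exists_norm_mul_eq_algebraMap h2 hσ hτ hστ hfix hc0 hτc hg hcg
  have hh0 : h ≠ 0 := by
    rintro rfl
    rw [zero_mul, zero_mul, eq_comm, map_eq_zero] at hu
    exact hu0 hu
  have hP' := twist_smul h hP
  have hPu := unit_smul hh0 P.isUnit
  have hc' : (h • P.val) * τ.mapMatrix (h • P.val) = algebraMap F M u • 1 := by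
    rw [AlgEquiv.mapMatrix_smul', smul_mul_assoc, mul_smul_comm, hc, smul_smul, smul_smul, ← hu,
      mul_assoc]
  obtain ⟨e', he'⟩ := twist_comm hPu Q.isUnit hP' hQ
  have hnorm : e' * τ e' = 1 := by
    have h1 := (twist_relations hσ hτ hστ hPu Q.isUnit hc' hd he').1
    rw [AlgEquiv.commutes] at h1
    exact (mul_eq_right₀ ((map_ne_zero (algebraMap F M)).mpr hu0)).mp h1.symm
  obtain ⟨k, hk0, hk⟩ := exists_apply_eq_mul_of_norm_one hτ ht0 ht hnorm
  have hQ' := twist_smul k hQ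
  have hQu := unit_smul hk0 Q.isUnit
  have hPQ : (k • Q.val) * σ.mapMatrix (h • P.val) =
      (h • P.val) * τ.mapMatrix (k • Q.val) := by
    rw [smul_mul_assoc, he', AlgEquiv.mapMatrix_smul' τ k, mul_smul_comm, smul_smul, hk]
  obtain ⟨v', hv0, hv⟩ := twist_sq hσσ hQu hQ'
  have hτv := (twist_relations hσ hτ hστ hPu hQu hc' hv (e := 1) (by rw [hPQ, one_smul])).2
  rw [map_one, one_mul, one_mul] at hτv
  obtain ⟨v, rfl⟩ := hfix v' (fixed_of_mul_twist_eq_smul_one hσ hQu hv) hτv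
  exact ⟨h • P.val, k • Q.val, u, v, hu0, by simpa using hv0, hP', hQ', hc', hv, hPQ⟩

theorem brauerEquivalent_of_algEquiv_matrix {F A Q : Type} [Field F] [Ring A] [Algebra F A]
    [Ring Q] [Algebra F Q] (htors : BrauerEquivalent F (A ⊗[F] A) F) {N : ℕ} (hN : N ≠ 0)
    (e : A ⊗[F] Q ≃ₐ[F] Matrix (Fin N) (Fin N) F) : BrauerEquivalent F A Q := by
  obtain ⟨p, q, hp, hq, ⟨Θ⟩⟩ := htors
  refine ⟨N * p, q, mul_ne_zero hN hp, hq, ⟨AlgEquiv.symm ?_⟩⟩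
  exact (matrixEquivTensor (Fin q) F Q).trans <|
    (Algebra.TensorProduct.congr AlgEquiv.refl
      (Θ.symm.trans (matrixEquivTensor (Fin p) F (A ⊗[F] A)))).trans <|
    (Algebra.TensorProduct.congr AlgEquiv.refl
      (Algebra.TensorProduct.assoc F F F A A (Matrix (Fin p) (Fin p) F))).trans <|
    (Algebra.TensorProduct.assoc F F F Q A (A ⊗[F] Matrix (Fin p) (Fin p) F)).symm.trans <|
    (Algebra.TensorProduct.congr ((Algebra.TensorProduct.comm F Q A).trans e)
      (matrixEquivTensor (Fin p) F A).symm).trans <|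
    (Algebra.TensorProduct.comm F _ _).trans <|
    (matrixEquivTensor (Fin N) F (Matrix (Fin p) (Fin p) A)).symm.trans <|
    (Matrix.compAlgEquiv (Fin N) (Fin p) A F).trans <|
    Matrix.reindexAlgEquiv F A finProdFinEquiv

theorem Subalgebra.mem_of_forall_commute {F E : Type*} [Field F] [Ring E] [Algebra F E]
    (h2 : (2 : F) ≠ 0) {S C : Subalgebra F E} {s j : E} {x v : F} (hx : x ≠ 0) (hv : v ≠ 0)
    (hs : s * s = algebraMap F E x) (hj : j * j = algebraMap F E v) (hjs : j * s = -(s * j))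
    (hsC : s ∈ C) (hjC : j ∈ C) (hjS : j ∈ S) (hS : ∀ g ∈ C, g * s = s * g → g ∈ S)
    {f : E} (hf : f ∈ C) : f ∈ S := by
  have hsf : s * (s * f * s) = x • (f * s) := by
    rw [mul_assoc s f s, ← mul_assoc, hs, Algebra.smul_def]
  have hfs : s * f * s * s = x • (s * f) := by
    rw [mul_assoc, hs, ← Algebra.commutes, Algebra.smul_def]
  have h1 : x • f + s * f * s ∈ S := by
    refine hS _ (add_mem (C.smul_mem hf x) (mul_mem (mul_mem hsC hf) hsC)) ?_
    rw [add_mul, mul_add, hsf, hfs, smul_mul_assoc, mul_smul_comm, add_comm]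
  have h3 : (x • f - s * f * s) * j ∈ S := by
    refine hS _ (mul_mem (sub_mem (C.smul_mem hf x) (mul_mem (mul_mem hsC hf) hsC)) hjC) ?_
    rw [mul_assoc, hjs, ← mul_assoc s, mul_sub, hsf, mul_neg, ← mul_assoc, sub_mul (x • f), hfs,
      smul_mul_assoc, mul_smul_comm, ← neg_mul, neg_sub]
  have h4 : v • (x • f - s * f * s) ∈ S := by
    have := mul_mem h3 hjS
    rwa [mul_assoc, hj, ← Algebra.commutes, ← Algebra.smul_def] at this
  have h5 : (2 * x) • f ∈ S := by
    have := add_mem h1 (S.smul_mem h4 v⁻¹)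
    rw [smul_smul, inv_mul_cancel₀ hv, one_smul] at this
    convert this using 1
    rw [mul_smul, two_smul]
    abel
  have := S.smul_mem h5 (2 * x)⁻¹
  rwa [smul_smul, inv_mul_cancel₀ (mul_ne_zero h2 hx), one_smul] at this

section TwistedEnd

variable {F M n : Type*} [Field F] [Field M] [Algebra F M] [Fintype n]

/-- The `σ`-semilinear endomorphism `v ↦ P σ(v)`, as an `F`-linear map. -/
def twistedEnd (σ : M ≃ₐ[F] M) (P : Matrix n n M) : Module.End F (n → M) :=
  (P.mulVecLin.restrictScalars F).comp (σ.toLinearMap.compLeft n)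

theorem twistedEnd_apply (σ : M ≃ₐ[F] M) (P : Matrix n n M) (v : n → M) :
    twistedEnd σ P v = P.mulVec (σ ∘ v) := rfl

variable [DecidableEq n]

theorem twistedEnd_mul (σ τ : M ≃ₐ[F] M) (P Q : Matrix n n M) :
    twistedEnd σ P * twistedEnd τ Q = twistedEnd (σ * τ) (P * σ.mapMatrix Q) := by
  refine LinearMap.ext fun v => ?_
  simp only [Module.End.mul_apply, twistedEnd_apply, ← Matrix.mulVec_mulVec]
  congr 1
  ext i
  simp [Matrix.mulVec, dotProduct]

/-- Matrices over an extension field as `F`-linear endomorphisms. -/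
def matrixToEnd (F M n : Type*) [Field F] [Field M] [Algebra F M] [Fintype n] [DecidableEq n] :
    Matrix n n M →ₐ[F] Module.End F (n → M) :=
  AlgHom.ofLinearMap
    { toFun := twistedEnd 1
      map_add' := fun P Q => LinearMap.ext fun v => by simp [twistedEnd_apply, Matrix.add_mulVec]
      map_smul' := fun r P => LinearMap.ext fun v => by
        simp [twistedEnd_apply, Matrix.smul_mulVec] }
    (LinearMap.ext fun v => by simp [twistedEnd_apply]; rfl)
    (fun P Q => by
      change twistedEnd 1 (P * Q) = twistedEnd 1 P * twistedEnd 1 Q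
      rw [twistedEnd_mul]
      rfl)

theorem matrixToEnd_apply (P : Matrix n n M) : matrixToEnd F M n P = twistedEnd 1 P := rfl

theorem matrixToEnd_algebraMap_smul_one (r : F) :
    matrixToEnd F M n (algebraMap F M r • 1) = algebraMap F _ r := by
  rw [algebraMap_smul, ← Algebra.algebraMap_eq_smul_one, AlgHom.commutes]

theorem twistedEnd_mul_self {σ : M ≃ₐ[F] M} (hσ : ∀ z, σ (σ z) = z) {P : Matrix n n M} {u : F}
    (hP : P * σ.mapMatrix P = algebraMap F M u • 1) :
    twistedEnd σ P * twistedEnd σ P = algebraMap F _ u := by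
  have : σ * σ = 1 := AlgEquiv.ext hσ
  rw [twistedEnd_mul, this, hP, ← matrixToEnd_apply, matrixToEnd_algebraMap_smul_one]

theorem twistedEnd_mul_matrixToEnd (σ : M ≃ₐ[F] M) (P X : Matrix n n M) :
    twistedEnd σ P * matrixToEnd F M n X = twistedEnd σ (P * σ.mapMatrix X) := by
  rw [matrixToEnd_apply, twistedEnd_mul, mul_one]

theorem matrixToEnd_mul_twistedEnd (σ : M ≃ₐ[F] M) (P X : Matrix n n M) :
    matrixToEnd F M n X * twistedEnd σ P = twistedEnd σ (X * P) := by
  rw [matrixToEnd_apply, twistedEnd_mul, one_mul]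
  rfl

theorem exists_matrixToEnd_eq {f : Module.End F (n → M)}
    (hf : ∀ z : M, f * matrixToEnd F M n (z • 1) = matrixToEnd F M n (z • 1) * f) :
    ∃ X, matrixToEnd F M n X = f := by
  have hsmul (z : M) (v : n → M) : matrixToEnd F M n (z • 1) v = z • v := by
    rw [matrixToEnd_apply, twistedEnd_apply, Matrix.smul_mulVec, Matrix.one_mulVec]
    rfl
  let g : (n → M) →ₗ[M] (n → M) :=
    { toFun := f
      map_add' := map_add f
      map_smul' := fun z v => by
        have := LinearMap.congr_fun (hf z) v
        rw [Module.End.mul_apply, Module.End.mul_apply, hsmul, hsmul] at this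
        exact this }
  refine ⟨LinearMap.toMatrix' g, LinearMap.ext fun v => ?_⟩
  rw [matrixToEnd_apply, twistedEnd_apply]
  exact LinearMap.toMatrix'_mulVec g v

end TwistedEnd

theorem QuaternionAlgebra.Basis.commute_liftHom {R E : Type*} [CommRing R] [Ring E] [Algebra R E]
    {c₁ c₂ c₃ : R} (b : QuaternionAlgebra.Basis E c₁ c₂ c₃) {X : E} (hi : Commute X b.i)
    (hj : Commute X b.j) (q : QuaternionAlgebra R c₁ c₂ c₃) : Commute X (b.liftHom q) := by
  have hk : Commute X b.k := b.i_mul_j ▸ hi.mul_right hj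
  have h1 : Commute X (algebraMap R E q.re) := (Algebra.commutes _ _).symm
  exact ((h1.add_right (hi.smul_right _)).add_right
    (hj.smul_right _)).add_right (hk.smul_right _)

section Splitting

variable {F M A n : Type*} [Field F] [Field M] [Algebra F M] [Ring A] [Algebra F A] [Fintype n]
  [DecidableEq n]

/-- The homomorphism from a tensor product of two quaternion algebras given by commuting pairs of
anticommuting elements. -/
def quaternionTensorLift {E : Type*} [Ring E] [Algebra F E] {a b c d : F}
    (p : QuaternionAlgebra.Basis E a 0 b) (q : QuaternionAlgebra.Basis E c 0 d)
    (hii : Commute p.i q.i) (hij : Commute p.i q.j) (hji : Commute p.j q.i)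
    (hjj : Commute p.j q.j) : (ℍ[F, a, b] ⊗[F] ℍ[F, c, d]) →ₐ[F] E :=
  Algebra.TensorProduct.lift p.liftHom q.liftHom fun z w =>
    (p.commute_liftHom (q.commute_liftHom hii hij w).symm (q.commute_liftHom hji hjj w).symm z).symm

theorem quaternionTensorLift_tmul {E : Type*} [Ring E] [Algebra F E] {a b c d : F}
    {p : QuaternionAlgebra.Basis E a 0 b} {q : QuaternionAlgebra.Basis E c 0 d}
    (hii : Commute p.i q.i) (hij : Commute p.i q.j) (hji : Commute p.j q.i)
    (hjj : Commute p.j q.j) (z : ℍ[F, a, b]) (w : ℍ[F, c, d]) :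
    quaternionTensorLift p q hii hij hji hjj (z ⊗ₜ w) = p.liftHom z * q.liftHom w :=
  Algebra.TensorProduct.lift_tmul ..

theorem commute_quaternionTensorLift {E : Type*} [Ring E] [Algebra F E] {a b c d : F}
    {p : QuaternionAlgebra.Basis E a 0 b} {q : QuaternionAlgebra.Basis E c 0 d}
    {hii : Commute p.i q.i} {hij : Commute p.i q.j} {hji : Commute p.j q.i}
    {hjj : Commute p.j q.j} {X : E} (h1 : Commute X p.i) (h2 : Commute X p.j)
    (h3 : Commute X q.i) (h4 : Commute X q.j) (w : ℍ[F, a, b] ⊗[F] ℍ[F, c, d]) :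
    Commute X (quaternionTensorLift p q hii hij hji hjj w) := by
  induction w with
  | zero => simp
  | add w₁ w₂ h h' => rw [map_add]; exact h.add_right h'
  | tmul z w =>
    rw [quaternionTensorLift_tmul]
    exact (p.commute_liftHom h1 h2 z).mul_right (q.commute_liftHom h3 h4 w)

theorem QuaternionAlgebra.Basis.i_mem_range {E : Type*} [Ring E] [Algebra F E] {a b : F}
    (p : QuaternionAlgebra.Basis E a 0 b) : p.i ∈ p.liftHom.range :=
  ⟨⟨0, 1, 0, 0⟩, by simp [QuaternionAlgebra.Basis.liftHom, QuaternionAlgebra.Basis.lift]⟩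

theorem QuaternionAlgebra.Basis.j_mem_range {E : Type*} [Ring E] [Algebra F E] {a b : F}
    (p : QuaternionAlgebra.Basis E a 0 b) : p.j ∈ p.liftHom.range :=
  ⟨⟨0, 0, 1, 0⟩, by simp [QuaternionAlgebra.Basis.liftHom, QuaternionAlgebra.Basis.lift]⟩

theorem Subalgebra.eq_top_of_twistedEnd_mem (h2 : (2 : F) ≠ 0) {x y u v : F} (hx : x ≠ 0)
    (hy : y ≠ 0) (hu : u ≠ 0) (hv : v ≠ 0) {s t : M}
    (hgen : Algebra.adjoin F ({s, t} : Set M) = ⊤) (ψ : (M ⊗[F] A) ≃ₐ[M] Matrix n n M)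
    {S : Subalgebra F (Module.End F (n → M))} {I J : Module.End F (n → M)}
    (hs2 : matrixToEnd F M n (s • 1) * matrixToEnd F M n (s • 1) = algebraMap F _ x)
    (ht2 : matrixToEnd F M n (t • 1) * matrixToEnd F M n (t • 1) = algebraMap F _ y)
    (hI2 : I * I = algebraMap F _ u) (hJ2 : J * J = algebraMap F _ v)
    (hIt : I * matrixToEnd F M n (t • 1) = -(matrixToEnd F M n (t • 1) * I))
    (hJs : J * matrixToEnd F M n (s • 1) = -(matrixToEnd F M n (s • 1) * J))
    (hJt : J * matrixToEnd F M n (t • 1) = matrixToEnd F M n (t • 1) * J)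
    (hI : I ∈ S) (hJ : J ∈ S) (hs : matrixToEnd F M n (s • 1) ∈ S)
    (ht : matrixToEnd F M n (t • 1) ∈ S)
    (hψ : ∀ a : A, matrixToEnd F M n (ψ (1 ⊗ₜ a)) ∈ S) : S = ⊤ := by
  let ι : M →ₐ[F] Module.End F (n → M) :=
    (matrixToEnd F M n).comp (Algebra.ofId M _ |>.restrictScalars F)
  have hι (z : M) : ι z = matrixToEnd F M n (z • 1) := by
    rw [← Algebra.algebraMap_eq_smul_one]; rfl
  have hscalar (z : M) : matrixToEnd F M n (z • 1) ∈ S := by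
    have h : Algebra.adjoin F {s, t} ≤ S.comap ι := Algebra.adjoin_le (by
      rintro z (rfl | rfl)
      · exact (Subalgebra.mem_comap _ _ _).mpr ((hι _).symm ▸ hs)
      · exact (Subalgebra.mem_comap _ _ _).mpr ((hι _).symm ▸ ht))
    rw [hgen] at h
    exact hι z ▸ h (Algebra.mem_top (x := z))
  have hmat (X : Matrix n n M) : matrixToEnd F M n X ∈ S := by
    have hX : X ∈ Submodule.span M (Set.range fun a : A => ψ (1 ⊗ₜ a)) :=
      span_range_splitting ψ ▸ Submodule.mem_top
    induction hX using Submodule.span_induction with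
    | mem _ h => obtain ⟨a, rfl⟩ := h; exact hψ a
    | zero => rw [map_zero]; exact zero_mem S
    | add _ _ _ _ h h' => rw [map_add]; exact add_mem h h'
    | smul z X _ h =>
      rw [← one_mul X, ← smul_mul_assoc, map_mul]
      exact mul_mem (hscalar z) h
  refine eq_top_iff.mpr fun f _ => ?_
  refine S.mem_of_forall_commute (C := ⊤) h2 hy hu ht2 hI2 hIt Algebra.mem_top Algebra.mem_top hI
    (fun g _ hg => ?_) (Algebra.mem_top (x := f))
  have hst : matrixToEnd F M n (t • 1) * matrixToEnd F M n (s • 1) =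
      matrixToEnd F M n (s • 1) * matrixToEnd F M n (t • 1) := by
    rw [← hι, ← hι, ← map_mul, ← map_mul, mul_comm]
  have hC {g : Module.End F (n → M)} :
      g ∈ Subalgebra.centralizer F {matrixToEnd F M n (t • 1)} ↔
        g * matrixToEnd F M n (t • 1) = matrixToEnd F M n (t • 1) * g := by
    rw [Subalgebra.mem_centralizer_iff]
    simp [eq_comm]
  refine S.mem_of_forall_commute h2 hx hv hs2 hJ2 hJs (hC.mpr hst.symm) (hC.mpr hJt) hJ
    (fun g hgt hgs => ?_) (hC.mpr hg)
  obtain ⟨X, rfl⟩ := exists_matrixToEnd_eq (f := g) fun z => by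
    have h : Algebra.adjoin F {s, t} ≤ (Subalgebra.centralizer F {g}).comap ι :=
      Algebra.adjoin_le (by
        rintro z (rfl | rfl) <;>
        simp only [SetLike.mem_coe, Subalgebra.mem_comap, Subalgebra.mem_centralizer_iff,
          Set.mem_singleton_iff, forall_eq, hι]
        · exact hgs
        · exact hC.mp hgt)
    rw [hgen] at h
    have := h (Algebra.mem_top (x := z))
    simpa only [SetLike.mem_coe, Subalgebra.mem_comap, Subalgebra.mem_centralizer_iff,
          Set.mem_singleton_iff, forall_eq, hι] using this
  exact hmat X

/-- Twisting data for a splitting `ψ` of `A` realise `A ⊗ (u, y) ⊗ (x, v)` inside the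
endomorphisms of `Mⁿ`, and dimensions match. -/
theorem nonempty_algEquiv_end [FiniteDimensional F A] (h2 : (2 : F) ≠ 0) {x y u v : F}
    (hx : x ≠ 0) (hy : y ≠ 0) (hu : u ≠ 0) (hv : v ≠ 0) {s t : M} (hs2 : s ^ 2 = algebraMap F M x)
    (ht2 : t ^ 2 = algebraMap F M y)
    (hgen : Algebra.adjoin F ({s, t} : Set M) = ⊤) (hdeg : Module.finrank F M = 4)
    (ψ : (M ⊗[F] A) ≃ₐ[M] Matrix n n M)
    {σ τ : M ≃ₐ[F] M} (hσ : ∀ z, σ (σ z) = z) (hτ : ∀ z, τ (τ z) = z)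
    (hστ : ∀ z, τ (σ z) = σ (τ z)) (hσs : σ s = -s) (hσt : σ t = t) (hτs : τ s = s)
    (hτt : τ t = -t) {P Q : Matrix n n M}
    (hP : ∀ a : A, P * τ.mapMatrix (ψ (1 ⊗ₜ a)) = ψ (1 ⊗ₜ a) * P)
    (hQ : ∀ a : A, Q * σ.mapMatrix (ψ (1 ⊗ₜ a)) = ψ (1 ⊗ₜ a) * Q)
    (hP2 : P * τ.mapMatrix P = algebraMap F M u • 1)
    (hQ2 : Q * σ.mapMatrix Q = algebraMap F M v • 1)
    (hPQ : Q * σ.mapMatrix P = P * τ.mapMatrix Q) :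
    Nonempty (A ⊗[F] (ℍ[F, u, y] ⊗[F] ℍ[F, x, v]) ≃ₐ[F] Module.End F (n → M)) := by
  have : FiniteDimensional F M := Module.finite_of_finrank_pos (by omega)
  let μ := matrixToEnd F M n
  let φ : A →ₐ[F] Matrix n n M :=
    (ψ.toAlgHom.restrictScalars F).comp Algebra.TensorProduct.includeRight
  have hmul (z w : M) : μ (z • 1) * μ (w • 1) = μ ((z * w) • 1) := by
    rw [← map_mul, smul_mul_smul_comm, one_mul]
  have htwist (ρ : M ≃ₐ[F] M) (R : Matrix n n M) (z : M) :
      twistedEnd ρ R * μ (z • 1) = μ (ρ z • 1) * twistedEnd ρ R := by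
    rw [twistedEnd_mul_matrixToEnd, matrixToEnd_mul_twistedEnd, AlgEquiv.mapMatrix_smul', map_one,
      mul_smul_comm, smul_mul_assoc, mul_one, one_mul]
  have hneg (z : M) : μ (-z • 1) = -μ (z • 1) := by rw [neg_smul, map_neg]
  have hS : μ (s • 1) * μ (s • 1) = algebraMap F _ x := by
    rw [hmul, ← sq, hs2, matrixToEnd_algebraMap_smul_one]
  have hT : μ (t • 1) * μ (t • 1) = algebraMap F _ y := by
    rw [hmul, ← sq, ht2, matrixToEnd_algebraMap_smul_one]
  have hI := twistedEnd_mul_self hτ hP2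
  have hJ := twistedEnd_mul_self hσ hQ2
  have hIt : twistedEnd τ P * μ (t • 1) = -(μ (t • 1) * twistedEnd τ P) := by
    rw [htwist, hτt, hneg]
    exact LinearMap.ext fun _ => rfl
  have hJs : twistedEnd σ Q * μ (s • 1) = -(μ (s • 1) * twistedEnd σ Q) := by
    rw [htwist, hσs, hneg]
    exact LinearMap.ext fun _ => rfl
  have hIs : Commute (twistedEnd τ P) (μ (s • 1)) := by
    rw [Commute, SemiconjBy, htwist, hτs]
  have hJt : Commute (twistedEnd σ Q) (μ (t • 1)) := by
    rw [Commute, SemiconjBy, htwist, hσt]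
  have hIJ : Commute (twistedEnd τ P) (twistedEnd σ Q) := by
    rw [Commute, SemiconjBy, twistedEnd_mul, twistedEnd_mul, hPQ,
      show τ * σ = σ * τ from AlgEquiv.ext hστ]
  have hst : Commute (μ (t • 1)) (μ (s • 1)) := by
    rw [Commute, SemiconjBy, hmul, hmul, mul_comm]
  have hφz (a : A) (z : M) : Commute (μ (φ a)) (μ (z • 1)) := by
    rw [Commute, SemiconjBy, ← map_mul, ← map_mul, mul_smul_comm, smul_mul_assoc, mul_one, one_mul]
  have hφI (a : A) : Commute (μ (φ a)) (twistedEnd τ P) := by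
    rw [Commute, SemiconjBy, matrixToEnd_mul_twistedEnd, twistedEnd_mul_matrixToEnd]
    exact congrArg _ (hP a).symm
  have hφJ (a : A) : Commute (μ (φ a)) (twistedEnd σ Q) := by
    rw [Commute, SemiconjBy, matrixToEnd_mul_twistedEnd, twistedEnd_mul_matrixToEnd]
    exact congrArg _ (hQ a).symm
  let b₁ : QuaternionAlgebra.Basis (Module.End F (n → M)) u 0 y :=
    { i := twistedEnd τ P
      j := μ (t • 1)
      k := twistedEnd τ P * μ (t • 1)
      i_mul_i := by rw [hI, zero_smul, add_zero, Algebra.algebraMap_eq_smul_one]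
      j_mul_j := by rw [hT, Algebra.algebraMap_eq_smul_one]
      i_mul_j := rfl
      j_mul_i := by rw [hIt, zero_smul, zero_sub, neg_neg] }
  let b₂ : QuaternionAlgebra.Basis (Module.End F (n → M)) x 0 v :=
    { i := μ (s • 1)
      j := twistedEnd σ Q
      k := μ (s • 1) * twistedEnd σ Q
      i_mul_i := by rw [hS, zero_smul, add_zero, Algebra.algebraMap_eq_smul_one]
      j_mul_j := by rw [hJ, Algebra.algebraMap_eq_smul_one]
      i_mul_j := rfl
      j_mul_i := by rw [hJs, zero_smul, zero_sub] }
  let κ := quaternionTensorLift b₁ b₂ hIs hIJ hst hJt.symm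
  let Ψ : A ⊗[F] (ℍ[F, u, y] ⊗[F] ℍ[F, x, v]) →ₐ[F] Module.End F (n → M) :=
    Algebra.TensorProduct.lift (μ.comp φ) κ fun a w =>
      commute_quaternionTensorLift (hφI a) (hφz a t) (hφz a s) (hφJ a) w
  have hκ (w) : κ w ∈ Ψ.range := ⟨1 ⊗ₜ w, by simp [Ψ]⟩
  have hb₁ {f} (hf : f ∈ b₁.liftHom.range) : f ∈ Ψ.range := by
    obtain ⟨q, rfl⟩ := hf
    convert hκ (q ⊗ₜ 1)
    rw [quaternionTensorLift_tmul, map_one, mul_one]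
    rfl
  have hb₂ {f} (hf : f ∈ b₂.liftHom.range) : f ∈ Ψ.range := by
    obtain ⟨q, rfl⟩ := hf
    convert hκ (1 ⊗ₜ q)
    rw [quaternionTensorLift_tmul, map_one, one_mul]
    rfl
  have hsurj : Function.Surjective Ψ := by
    rw [← AlgHom.range_eq_top]
    exact Subalgebra.eq_top_of_twistedEnd_mem h2 hx hy hu hv hgen ψ hS hT hI hJ hIt hJs hJt
      (hb₁ b₁.i_mem_range) (hb₂ b₂.j_mem_range) (hb₂ b₂.i_mem_range) (hb₁ b₁.j_mem_range)
      fun a => ⟨a ⊗ₜ 1, by simp [Ψ]; rfl⟩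
  have hA : Module.finrank F A = Fintype.card n * Fintype.card n := by
    rw [← Module.finrank_baseChange (R := M), ψ.toLinearEquiv.finrank_eq, Module.finrank_matrix]
    simp
  have hdim : Module.finrank F (A ⊗[F] (ℍ[F, u, y] ⊗[F] ℍ[F, x, v])) =
      Module.finrank F (Module.End F (n → M)) := by
    rw [Module.finrank_tensorProduct, Module.finrank_tensorProduct, hA,
      QuaternionAlgebra.finrank_eq_four, QuaternionAlgebra.finrank_eq_four,
      Module.finrank_linearMap, Module.finrank_pi_fintype]
    simp [hdeg]
    ring
  exact ⟨AlgEquiv.ofBijective Ψ ⟨(LinearMap.injective_iff_surjective_of_finrank_eq_finrank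
    (f := Ψ.toLinearMap) hdim).mpr hsurj, hsurj⟩⟩

end Splitting

theorem stmt_18 (F : Type) [Field F] (hchar : (2 : F) ≠ 0)
    (x y : F) (hx : x ≠ 0) (hy : y ≠ 0)
    (M : Type) [Field M] [Algebra F M] (s t : M)
    (hs : s ^ 2 = algebraMap F M x) (ht : t ^ 2 = algebraMap F M y)
    (hgen : Algebra.adjoin F ({s, t} : Set M) = ⊤)
    (hdeg : Module.finrank F M = 4)
    (A : Type) [Ring A] [Algebra F A] [FiniteDimensional F A]
    [Algebra.IsCentral F A] [IsSimpleRing A]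
    (htors : BrauerEquivalent F (A ⊗[F] A) F)
    (hsplit : ∃ m : ℕ, m ≠ 0 ∧
      Nonempty ((M ⊗[F] A) ≃ₐ[M] Matrix (Fin m) (Fin m) M)) :
    ∃ u v : F, u ≠ 0 ∧ v ≠ 0 ∧
      BrauerEquivalent F A (ℍ[F, u, y] ⊗[F] ℍ[F, x, v]) := by
  obtain ⟨σ, τ, hσs, hσt, hτs, hτt, hσ, hτ, hστ, hfix⟩ :=
    exists_biquadratic_aut hchar hx hy hs ht hgen hdeg
  obtain ⟨m, hm, ⟨ψ⟩⟩ := hsplit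
  have : Nonempty (Fin m) := ⟨⟨0, Nat.pos_of_ne_zero hm⟩⟩
  have hroot {z : M} {r : F} (hr : r ≠ 0) (hz : z ^ 2 = algebraMap F M r) : z ≠ 0 := by
    rintro rfl
    rw [zero_pow two_ne_zero, eq_comm, map_eq_zero] at hz
    exact hr hz
  have h2 : (2 : M) ≠ 0 := by
    rw [← map_ofNat (algebraMap F M) 2]
    exact (map_ne_zero _).mpr hchar
  have htors' := htors
  obtain ⟨p, q, hp, -, ⟨Θ⟩⟩ := htors'
  have : Nonempty (Fin p) := ⟨⟨0, Nat.pos_of_ne_zero hp⟩⟩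
  obtain ⟨P, Q, u, v, hu, hv, hP, hQ, hP2, hQ2, hPQ⟩ :=
    exists_normalized_twists ψ Θ h2 hσ hτ hστ hfix (hroot hx hs) (hroot hy ht) hσs hτt
  obtain ⟨e⟩ := nonempty_algEquiv_end hchar hx hy hu hv hs ht hgen hdeg ψ hσ hτ hστ hσs hσt hτs
    hτt hP hQ hP2 hQ2 hPQ
  have : FiniteDimensional F M := Module.finite_of_finrank_pos (by omega)
  exact ⟨u, v, hu, hv, brauerEquivalent_of_algEquiv_matrix htors
    (Module.finrank_pos (R := F) (M := Fin m → M)).ne'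
    (e.trans (algEquivMatrix (Module.finBasis F (Fin m → M))))⟩
end

section
/- For every prime p, there exists a continuous homomorphism Gal(ℚ̄/ℚ) → ℤ/pℤ that is not the composition of any continuous homomorphism Gal(ℚ̄/ℚ) → ℤ/p²ℤ with the reduction map ℤ/p²ℤ → ℤ/pℤ; in other words, the natural map H^1(Gal(ℚ̄/ℚ), ℤ/p²) → H^1(Gal(ℚ̄/ℚ), ℤ/p) is not surjective. -/
/-- The absolute Galois group `Gal(F_s/F)`, with its Krull topology.
For `F = ℚ`, the separable closure is an algebraic closure `ℚ̄`. -/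
abbrev AbsGal (F : Type) [Field F] : Type :=
  SeparableClosure F ≃ₐ[F] SeparableClosure F

open scoped Pointwise

section

variable {B G : Type*} [CommRing B] [Group G] [MulSemiringAction G B]

lemma smul_mem_pow_of_stabilizes {P : Ideal B} {σ : G} (hσ : ∀ x ∈ P, σ • x ∈ P) (n : ℕ)
    {x : B} (hx : x ∈ P ^ n) : σ • x ∈ P ^ n := by
  have h : P ≤ P.comap (MulSemiringAction.toRingHom G B σ) := hσ
  have := (Ideal.pow_right_mono h n).trans (Ideal.le_comap_pow _ n)
  exact this hx

lemma smul_sub_mem_pow_succ {P : Ideal B} {ρ : G} (h₀ : ∀ x, ρ • x - x ∈ P)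
    (h₁ : ∀ x ∈ P, ρ • x - x ∈ P ^ 2) (m : ℕ) :
    ∀ x ∈ P ^ m, ρ • x - x ∈ P ^ (m + 1) := by
  have hP : ∀ x ∈ P, ρ • x ∈ P := fun x hx ↦ by simpa using add_mem (h₀ x) hx
  induction m with
  | zero => simpa using h₀
  | succ m ih =>
    intro x hx
    rw [pow_succ] at hx
    induction hx using Submodule.mul_induction_on' with
    | mem_mul_mem a ha b hb =>
      have : ρ • (a * b) - a * b = (ρ • a - a) * ρ • b + a * (ρ • b - b) := by
        rw [smul_mul']; ring
      rw [this]
      refine add_mem ?_ ?_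
      · rw [pow_succ]
        exact Ideal.mul_mem_mul (ih a ha) (hP b hb)
      · rw [show m + 1 + 1 = m + 2 by rfl, pow_add]
        exact Ideal.mul_mem_mul ha (h₁ b hb)
    | add a _ b _ ha hb =>
      rw [smul_add, add_sub_add_comm]
      exact add_mem ha hb

/-- An automorphism acting trivially on `B ⧸ P` and on `P ⧸ P ^ 2` whose order is prime to the
residue characteristic is trivial. -/
lemma eq_one_of_wild_of_coprime [IsNoetherianRing B] [IsDomain B] [FaithfulSMul G B]
    {P : Ideal B} (hP : P ≠ ⊤) {l n : ℕ}
    (hl : (l : B) ∈ P) {ρ : G} (h₀ : ∀ x, ρ • x - x ∈ P) (h₁ : ∀ x ∈ P, ρ • x - x ∈ P ^ 2)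
    (hn : n.Coprime l) (hρ : ρ ^ n = 1) : ρ = 1 := by
  have key : ∀ m : ℕ, ∀ x, ρ • x - x ∈ P ^ m := by
    intro m
    induction m with
    | zero => simp
    | succ m ih =>
      intro x
      have hj : ∀ j : ℕ, ρ ^ j • x - x - j * (ρ • x - x) ∈ P ^ (m + 1) := by
        intro j
        induction j with
        | zero => simp
        | succ j hj =>
          have h2 := smul_sub_mem_pow_succ h₀ h₁ m _ (ih x)
          have h3 : ρ • (ρ ^ j • x - x) - (ρ ^ j • x - x) ∈ P ^ (m + 1) := by
            have e : ρ • (ρ ^ j • x - x) - (ρ ^ j • x - x) =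
              (ρ • (ρ ^ j • x - x - j * (ρ • x - x)) - (ρ ^ j • x - x - j * (ρ • x - x)))
              + j * (ρ • (ρ • x - x) - (ρ • x - x)) := by
              have hjρ : ρ • (j : B) = j := map_natCast (MulSemiringAction.toRingHom G B ρ) j
              simp only [smul_sub, smul_mul', hjρ]; ring
            rw [e]
            refine add_mem (sub_mem ?_ hj) (Ideal.mul_mem_left _ _ h2)
            exact smul_mem_pow_of_stabilizes
              (fun x hx ↦ by simpa using add_mem (h₀ x) hx) _ hj
          have e : ρ ^ (j + 1) • x - x - ((j + 1 : ℕ) : B) * (ρ • x - x) =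
              (ρ • (ρ ^ j • x - x) - (ρ ^ j • x - x)) + (ρ ^ j • x - x - j * (ρ • x - x)) := by
            rw [pow_succ', mul_smul, smul_sub]; push_cast; ring
          rw [e]
          exact add_mem h3 hj
      have h := hj n
      rw [hρ, one_smul, sub_self, zero_sub, neg_mem_iff] at h
      obtain ⟨u, v, huv⟩ : IsCoprime (n : ℤ) ((l : ℤ) ^ (m + 1)) :=
        (Nat.isCoprime_iff_coprime.mpr hn).pow_right
      have huv' : (u : B) * n + v * l ^ (m + 1) = 1 := by
        exact_mod_cast congrArg (Int.cast : ℤ → B) huv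
      have e : ρ • x - x = u * (n * (ρ • x - x)) + (v * (ρ • x - x)) * l ^ (m + 1) := by
        linear_combination (-(ρ • x - x)) * huv'
      rw [e]
      exact add_mem (Ideal.mul_mem_left _ _ h) (Ideal.mul_mem_left _ _ (Ideal.pow_mem_pow hl _))
  refine FaithfulSMul.eq_of_smul_eq_smul (α := B) fun x ↦ ?_
  have := Ideal.iInf_pow_eq_bot_of_isDomain P hP
  have hx : ρ • x - x ∈ (⨅ i : ℕ, P ^ i) := by
    simpa [Submodule.mem_iInf] using fun m ↦ key m x
  rw [this, Ideal.mem_bot, sub_eq_zero] at hx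
  rw [hx, one_smul]

/-- An element of tame inertia commuting with a Frobenius of degree one has order dividing
`l - 1`. -/
lemma pow_sub_one_eq_one_of_mem_inertia [IsDedekindDomain B] [FaithfulSMul G B]
    {P : Ideal B} [hPp : P.IsPrime] (hP : P ≠ ⊥) {l n : ℕ} (hl : (l : B) ∈ P) (hl0 : l ≠ 0) {τ σ : G}
    (hτ : τ ∈ P.inertia G) (hσ : ∀ x, σ • x - x ^ l ∈ P) (hστ : Commute σ τ)
    (hn : n.Coprime l) (hτn : τ ^ n = 1) : τ ^ (l - 1) = 1 := by
  have hσP : ∀ x, σ • x ∈ P ↔ x ∈ P := fun x ↦ by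
    refine ⟨fun h ↦ hPp.mem_of_pow_mem l ?_, fun h ↦ ?_⟩
    · simpa using sub_mem h (hσ x)
    · simpa using add_mem (hσ x) (Ideal.pow_mem_of_mem P h l (Nat.pos_of_ne_zero hl0))
  have hI : ∀ {ρ : G}, ρ ∈ P.inertia G → ∀ x ∈ P, ρ • x ∈ P :=
    fun hρ x hx ↦ by simpa using add_mem (hρ x) hx
  obtain ⟨π, hπ, hπ2⟩ : ∃ π ∈ P, π ∉ P ^ 2 := by
    obtain ⟨x, hx, hx'⟩ := Set.exists_of_ssubset
      (Ideal.pow_right_strictAnti P hP hPp.ne_top (show 1 < 2 by simp))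
    exact ⟨x, by simpa using hx, hx'⟩
  have hex : ∀ x ∈ P, ∃ a, x - a * π ∈ P ^ 2 := fun x hx ↦ by
    obtain ⟨d, e, he, h⟩ := Ideal.exists_mul_add_mem_pow_succ (i := 1) hP π x (by simpa) hπ2 (by simpa)
    exact ⟨d, by rw [← h]; ring_nf; exact he⟩
  have hcancel : ∀ c, c * π ∈ P ^ 2 → c ∈ P := fun c hc ↦ by
    have := Ideal.mul_add_mem_pow_succ_unique (i := 1) hP π c 0 0 0 hπ2 (zero_mem _) (zero_mem _)
      (by simpa [mul_comm] using hc)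
    simpa using this
  have hsq : ∀ {a b : B}, a ∈ P → b ∈ P → a * b ∈ P ^ 2 := fun ha hb ↦ by
    rw [pow_two]; exact Ideal.mul_mem_mul ha hb
  obtain ⟨a, ha⟩ := hex _ (hI hτ π hπ)
  obtain ⟨b, hb⟩ := hex _ ((hσP π).mpr hπ)
  have hτ2 : ∀ x ∈ P ^ 2, τ • x ∈ P ^ 2 := fun x ↦ smul_mem_pow_of_stabilizes (hI hτ) 2
  have hσ2 : ∀ x ∈ P ^ 2, σ • x ∈ P ^ 2 := fun x ↦
    smul_mem_pow_of_stabilizes (fun x hx ↦ (hσP x).mpr hx) 2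
  have hpowI : ∀ k, τ ^ k ∈ P.inertia G := fun k ↦ pow_mem hτ k
  have hak : ∀ k : ℕ, τ ^ k • π - a ^ k * π ∈ P ^ 2 := by
    intro k
    induction k with
    | zero => simp
    | succ k ih =>
      have e : τ ^ (k + 1) • π - a ^ (k + 1) * π = τ • (τ ^ k • π - a ^ k * π)
          + (τ • a ^ k - a ^ k) * τ • π + a ^ k * (τ • π - a * π) := by
        rw [pow_succ', mul_smul, smul_sub, smul_mul']; ring
      rw [e]
      exact add_mem (add_mem (hτ2 _ ih) (hsq (hτ _) (hI hτ π hπ))) (Ideal.mul_mem_left _ _ ha)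
  have haP : a ∉ P := fun h ↦ by
    have h1 : a ^ n * π - π ∈ P ^ 2 := by
      have := hak n
      rw [hτn, one_smul] at this
      rw [← neg_sub]; exact neg_mem this
    have hn0 : n ≠ 0 := by
      rintro rfl
      rw [Nat.coprime_zero_left] at hn
      exact hPp.one_notMem (by simpa [hn] using hl)
    apply hπ2
    have := sub_mem (hsq (Ideal.pow_mem_of_mem P h n (Nat.pos_of_ne_zero hn0)) hπ) h1
    simpa using this
  have hbP : b ∉ P := fun h ↦ by
    have h1 : σ • π ∈ P ^ 2 := by simpa using add_mem hb (hsq h hπ)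
    have h2 := smul_mem_pow_of_stabilizes (σ := σ⁻¹)
      (fun x hx ↦ (hσP _).mp (by rwa [smul_inv_smul])) 2 h1
    rw [inv_smul_smul] at h2
    exact hπ2 h2
  have h1 : τ • σ • π - a * b * π ∈ P ^ 2 := by
    have e : τ • σ • π - a * b * π = τ • (σ • π - b * π) + (τ • b - b) * τ • π
        + b * (τ • π - a * π) := by
      rw [smul_sub, smul_mul']; ring
    rw [e]
    exact add_mem (add_mem (hτ2 _ hb) (hsq (hτ _) (hI hτ π hπ))) (Ideal.mul_mem_left _ _ ha)
  have h2 : σ • τ • π - a ^ l * b * π ∈ P ^ 2 := by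
    have e : σ • τ • π - a ^ l * b * π = σ • (τ • π - a * π) + (σ • a - a ^ l) * σ • π
        + a ^ l * (σ • π - b * π) := by
      rw [smul_sub, smul_mul']; ring
    rw [e]
    exact add_mem (add_mem (hσ2 _ ha) (hsq (hσ _) ((hσP π).mpr hπ))) (Ideal.mul_mem_left _ _ hb)
  rw [← mul_smul, hστ.eq, mul_smul] at h2
  have h3 : a ^ (l - 1) - 1 ∈ P := by
    have h := hcancel ((a ^ (l - 1) - 1) * (a * b)) (by
      have := sub_mem h1 h2
      obtain ⟨k, rfl⟩ := Nat.exists_eq_succ_of_ne_zero hl0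
      have e : (a ^ (k.succ - 1) - 1) * (a * b) * π =
        (τ • σ • π - a * b * π) - (τ • σ • π - a ^ k.succ * b * π) := by
        rw [Nat.succ_sub_one, Nat.succ_eq_add_one, pow_succ]; ring
      rwa [e])
    exact (hPp.mem_or_mem h).resolve_right fun h' ↦ (hPp.mem_or_mem h').elim haP hbP
  refine eq_one_of_wild_of_coprime hPp.ne_top hl (hpowI _) (fun x hx ↦ ?_) hn
    (by rw [← pow_mul, mul_comm, pow_mul, hτn, one_pow])
  obtain ⟨c, hc⟩ := hex x hx
  set ρ := τ ^ (l - 1)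
  have e : ρ • x - x = ρ • (x - c * π) - (x - c * π) + (ρ • c - c) * ρ • π
      + c * (ρ • π - a ^ (l - 1) * π) + c * ((a ^ (l - 1) - 1) * π) := by
    rw [smul_sub, smul_mul']; ring
  rw [e]
  refine add_mem (add_mem (add_mem (sub_mem ?_ hc) (hsq (hpowI _ _) (hI (hpowI _) _ hπ)))
    (Ideal.mul_mem_left _ _ (hak _))) (Ideal.mul_mem_left _ _ (hsq h3 hπ))
  exact smul_mem_pow_of_stabilizes (hI (hpowI _)) 2 hc

end

section

open NumberField

lemma IsPrimitiveRoot.autToPow_eq_iff {R S : Type*} [CommRing R] [CommRing S] [IsDomain S]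
    [Algebra R S] {μ : S} {n : ℕ} [NeZero n] (hμ : IsPrimitiveRoot μ n) (f : S ≃ₐ[R] S)
    (u : (ZMod n)ˣ) : hμ.autToPow R f = u ↔ f μ = μ ^ (u : ZMod n).val := by
  refine ⟨fun h ↦ by rw [← hμ.autToPow_spec R f, h], fun h ↦ ?_⟩
  exact Units.ext (ZMod.val_injective n
    (hμ.pow_inj (ZMod.val_lt _) (ZMod.val_lt _) ((hμ.autToPow_spec R f).trans h)))

lemma autToPow_surjOn_inertia {N : Type*} [Field N] [NumberField N] [IsGalois ℚ N] {l : ℕ}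
    [Fact l.Prime] {ζ : N} (hζ : IsPrimitiveRoot ζ l) (P : Ideal (𝓞 N)) [P.IsPrime]
    [P.LiesOver (Ideal.span {(l : ℤ)})] (u : (ZMod l)ˣ) :
    ∃ τ ∈ P.inertia Gal(N/ℚ), hζ.autToPow ℚ τ = u := by
  let L := IntermediateField.adjoin ℚ {ζ}
  have : IsCyclotomicExtension {l} ℚ L := hζ.intermediateField_adjoin_isCyclotomicExtension ℚ
  let H := fixingSubgroup Gal(N/ℚ) (L : Set N)
  have : IsGaloisGroup H (𝓞 L) (𝓞 N) := .of_isFractionRing _ _ _ L N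
  have hl0 : Ideal.span {(l : ℤ)} ≠ ⊥ := by simp [(Fact.out : l.Prime).ne_zero]
  have hlp : (Ideal.span {(l : ℤ)}).IsPrime := by
    rw [Ideal.span_singleton_prime (by simp [(Fact.out : l.Prime).ne_zero])]
    exact Nat.prime_iff_prime_int.mp Fact.out
  have : (Ideal.span {(l : ℤ)}).IsMaximal := hlp.isMaximal hl0
  have hP0 : P ≠ ⊥ := Ideal.ne_bot_of_liesOver_of_ne_bot hl0 P
  let Q := P.under (𝓞 L)
  have : P.LiesOver Q := ⟨rfl⟩
  have : Q.LiesOver (Ideal.span {(l : ℤ)}) := Ideal.LiesOver.tower_bot P Q _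
  have hQ0 : Q ≠ ⊥ := Ideal.ne_bot_of_liesOver_of_ne_bot hl0 Q
  have : Q.IsMaximal := (inferInstance : Q.IsPrime).isMaximal hQ0
  have hker : (hζ.autToPow ℚ).ker = H := by
    ext τ
    rw [MonoidHom.mem_ker, mem_fixingSubgroup_iff, Units.ext_iff, Units.val_one]
    have h1 : hζ.autToPow ℚ τ = (1 : ZMod l) ↔ τ ζ = ζ := by
      rw [← Units.val_one, ← Units.ext_iff, hζ.autToPow_eq_iff, Units.val_one, ZMod.val_one,
        pow_one]
    rw [h1]
    refine ⟨fun h ↦ ?_, fun h ↦ h ζ (IntermediateField.mem_adjoin_simple_self ℚ ζ)⟩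
    have : L ≤ IntermediateField.fixedField (Subgroup.zpowers τ) := by
      rw [IntermediateField.adjoin_simple_le_iff, IntermediateField.mem_fixedField_iff]
      intro f hf
      have : Subgroup.zpowers τ ≤ MulAction.stabilizer Gal(N/ℚ) ζ := by
        rw [Subgroup.zpowers_le]; exact h
      exact this hf
    exact fun y hy ↦ (IntermediateField.mem_fixedField_iff _ _).mp (this hy) τ
      (Subgroup.mem_zpowers τ)
  have cardG : Nat.card (P.inertia Gal(N/ℚ)) = P.ramificationIdx ℤ := by
    rw [Ideal.card_inertia_eq_ramificationIdxIn (Ideal.span {(l : ℤ)}) P,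
      Ideal.ramificationIdxIn_eq_ramificationIdx _ P Gal(N/ℚ)]
  have cardH : Nat.card (P.inertia H) = P.ramificationIdx (𝓞 L) := by
    have : Finite (𝓞 L ⧸ Q) := Ring.HasFiniteQuotients.finiteQuotient hQ0
    rw [Ideal.card_inertia_eq_ramificationIdxIn Q P,
      Ideal.ramificationIdxIn_eq_ramificationIdx _ P H]
  have hQ : Q.ramificationIdx ℤ = l - 1 :=
    IsCyclotomicExtension.Rat.ramificationIdx_eq_of_prime l L Q
  have htower : P.ramificationIdx ℤ = Q.ramificationIdx ℤ * P.ramificationIdx (𝓞 L) :=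
    Ideal.ramificationIdx_tower Q P
  let f := (hζ.autToPow ℚ).comp (P.inertia Gal(N/ℚ)).subtype
  have hf : Function.Surjective f := by
    refine MonoidHom.surjective_of_card_ker_le_div f ?_
    have : Nat.card f.ker = Nat.card (P.inertia H) := by
      have h : f.ker.map (P.inertia Gal(N/ℚ)).subtype = (P.inertia H).map H.subtype := by
        rw [AddSubgroup.inertia_map_subtype P.toAddSubgroup H, ← hker, inf_comm]
        exact Subgroup.subgroupOf_map_subtype (hζ.autToPow ℚ).ker (P.inertia Gal(N/ℚ))
      rw [← Subgroup.card_map_of_injective (K := f.ker) (P.inertia Gal(N/ℚ)).subtype_injective, h,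
        Subgroup.card_map_of_injective H.subtype_injective]
    rw [this, cardG, cardH, htower, hQ, Nat.card_eq_fintype_card, ZMod.card_units,
      Nat.mul_div_cancel_left _ (Nat.sub_pos_of_lt (Fact.out : l.Prime).one_lt)]
  obtain ⟨τ, hτ⟩ := hf u
  exact ⟨τ, τ.2, hτ⟩

/-- In an abelian extension of `ℚ` containing the `l`-th roots of unity, every automorphism of
`ℚ(ζ)` lifts to an automorphism whose order divides `l ^ a * (l - 1)`. -/
lemma exists_autToPow_eq_and_pow_eq_one {N : Type*} [Field N] [NumberField N] [IsGalois ℚ N]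
    (hcomm : ∀ a b : Gal(N/ℚ), Commute a b) {l : ℕ} [Fact l.Prime] {ζ : N}
    (hζ : IsPrimitiveRoot ζ l) (u : (ZMod l)ˣ) :
    ∃ τ : Gal(N/ℚ), hζ.autToPow ℚ τ = u ∧ ∃ a : ℕ, τ ^ (l ^ a * (l - 1)) = 1 := by
  have hl : l.Prime := Fact.out
  have hl0 : Ideal.span {(l : ℤ)} ≠ ⊥ := by simp [hl.ne_zero]
  have hlp : (Ideal.span {(l : ℤ)}).IsPrime := by
    rw [Ideal.span_singleton_prime (by simp [hl.ne_zero])]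
    exact Nat.prime_iff_prime_int.mp hl
  obtain ⟨⟨P, _, _⟩⟩ : Nonempty (Ideal.primesOver (Ideal.span {(l : ℤ)}) (𝓞 N)) := inferInstance
  have hP0 : P ≠ ⊥ := Ideal.ne_bot_of_liesOver_of_ne_bot hl0 P
  have hPl : P.under ℤ = Ideal.span {(l : ℤ)} := (P.over_def (Ideal.span {(l : ℤ)})).symm
  have hlP : (l : 𝓞 N) ∈ P := by
    have : (l : ℤ) ∈ P.under ℤ := hPl ▸ Ideal.mem_span_singleton_self _
    simpa using this
  obtain ⟨τ, hτ, rfl⟩ := autToPow_surjOn_inertia hζ P u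
  have : Finite (𝓞 N ⧸ P) := Ring.HasFiniteQuotients.finiteQuotient hP0
  obtain ⟨σ, hσ⟩ := IsArithFrobAt.exists_of_isInvariant ℤ Gal(N/ℚ) P
  have hcard : Nat.card (ℤ ⧸ P.under ℤ) = l := by
    rw [hPl, Nat.card_congr (Int.quotientSpanNatEquivZMod l).toEquiv, Nat.card_zmod]
  obtain ⟨a, n, hn, hord⟩ := Nat.exists_eq_pow_mul_and_not_dvd (orderOf_pos τ).ne' l hl.ne_one
  refine ⟨τ, rfl, a, ?_⟩
  have : FaithfulSMul Gal(N/ℚ) (𝓞 N) := IsGaloisGroup.faithful ℤ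
  rw [pow_mul]
  refine pow_sub_one_eq_one_of_mem_inertia hP0 hlP hl.ne_zero (pow_mem hτ _) (fun x ↦ ?_)
    (hcomm σ _) ((Nat.Prime.coprime_iff_not_dvd hl).mpr hn).symm
    (by rw [← pow_mul, ← hord, pow_orderOf_eq_one])
  have := hσ x
  rwa [hcard] at this

end

lemma exists_prime_dvd_sub_one_not_sq_dvd (p : ℕ) [Fact p.Prime] :
    ∃ l : ℕ, l.Prime ∧ l ≠ p ∧ p ∣ l - 1 ∧ ¬ p ^ 2 ∣ l - 1 := by
  have hp : p.Prime := Fact.out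
  have hu : IsUnit ((1 + p : ℕ) : ZMod (p ^ 2)) := by
    rw [ZMod.isUnit_iff_coprime]
    exact Nat.Coprime.pow_right 2 (by simp)
  obtain ⟨l, hlp, hl, h⟩ := Nat.forall_exists_prime_gt_and_eq_mod hu p
  rw [ZMod.natCast_eq_natCast_iff] at h
  have h1 : l - 1 ≡ p [MOD p ^ 2] := by
    refine Nat.ModEq.add_left_cancel' 1 ?_
    rwa [Nat.add_sub_cancel' hl.one_lt.le]
  refine ⟨l, hl, hlp.ne', ?_, fun h2 ↦ ?_⟩
  · exact (h1.dvd_iff (dvd_pow_self p two_ne_zero)).mpr dvd_rfl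
  · have h3 := (h1.dvd_iff dvd_rfl).mp h2
    have := Nat.le_of_dvd hp.pos h3
    nlinarith [hp.one_lt]

lemma exists_unitsHom_ne_zero {p l : ℕ} [Fact p.Prime] [Fact l.Prime] (h : p ∣ l - 1) :
    ∃ (ψ : (ZMod l)ˣ →* Multiplicative (ZMod p)) (u : (ZMod l)ˣ), (ψ u).toAdd ≠ 0 := by
  have hd : p ∣ Nat.card (ZMod l)ˣ := by
    rwa [Nat.card_eq_fintype_card, ZMod.card_units]
  let e := zmodCyclicMulEquiv (G := (ZMod l)ˣ) inferInstance
  refine ⟨(AddMonoidHom.toMultiplicative (ZMod.castHom hd (ZMod p)).toAddMonoidHom).comp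
    e.symm.toMonoidHom, e (Multiplicative.ofAdd 1), ?_⟩
  have h : ZMod.castHom hd (ZMod p) 1 ≠ 0 := by rw [map_one]; exact one_ne_zero
  rw [MonoidHom.comp_apply, MulEquiv.coe_toMonoidHom, e.symm_apply_apply]
  exact h

/-- A homomorphism to `ℤ/p²` lifting a nonzero value `x` in `ℤ/p` takes values of order
divisible by `p²`. -/
lemma sq_dvd_of_pow_eq_one {G : Type*} [Group G] {p m : ℕ} [Fact p.Prime]
    (φ : G →* Multiplicative (ZMod (p ^ 2))) {g : G} (hg : φ (g ^ m) = 1)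
    (h0 : ZMod.castHom (dvd_pow_self p two_ne_zero) (ZMod p) (φ g).toAdd ≠ 0) : p ^ 2 ∣ m := by
  have hp : p.Prime := Fact.out
  set x : ZMod (p ^ 2) := (φ g).toAdd
  have hm : (m : ZMod (p ^ 2)) * x = 0 := by
    have := congrArg Multiplicative.toAdd hg
    rwa [map_pow, toAdd_pow, nsmul_eq_mul, toAdd_one] at this
  have hxu : IsUnit x := by
    rw [← ZMod.natCast_zmod_val x, ZMod.isUnit_iff_coprime]
    refine Nat.Coprime.pow_right 2 (Nat.Coprime.symm ((Nat.Prime.coprime_iff_not_dvd hp).mpr ?_))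
    rw [← ZMod.natCast_zmod_val x, map_natCast] at h0
    rwa [← ZMod.natCast_eq_zero_iff]
  rwa [hxu.mul_left_eq_zero, ZMod.natCast_eq_zero_iff] at hm

lemma isOpen_ker_autToPow {k K : Type*} [Field k] [Field K] [Algebra k K]
    [Algebra.IsIntegral k K] {l : ℕ} [Fact l.Prime] {ζ : K} (hζ : IsPrimitiveRoot ζ l) :
    IsOpen ((hζ.autToPow k).ker : Set Gal(K/k)) := by
  have : FiniteDimensional k (IntermediateField.adjoin k {ζ}) :=
    IntermediateField.adjoin.finiteDimensional (Algebra.IsIntegral.isIntegral ζ)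
  refine Subgroup.isOpen_mono ?_ (IntermediateField.fixingSubgroup_isOpen
    (IntermediateField.adjoin k {ζ}))
  intro τ hτ
  have h : τ ζ = ζ := hτ ⟨ζ, IntermediateField.mem_adjoin_simple_self k ζ⟩
  rw [MonoidHom.mem_ker, hζ.autToPow_eq_iff, h, Units.val_one, ZMod.val_one, pow_one]

lemma exists_autToPow_eq_and_pow_eq_one_of_finiteDimensional {N : Type*} [Field N]
    [inst : Algebra ℚ N] [FiniteDimensional ℚ N] [IsGalois ℚ N]
    (hcomm : ∀ a b : Gal(N/ℚ), Commute a b) {l : ℕ} [Fact l.Prime] {ζ : N}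
    (hζ : IsPrimitiveRoot ζ l) (u : (ZMod l)ˣ) :
    ∃ τ : Gal(N/ℚ), hζ.autToPow ℚ τ = u ∧ ∃ a, τ ^ (l ^ a * (l - 1)) = 1 := by
  have : CharZero N := algebraRat.charZero N
  obtain rfl : inst = DivisionRing.toRatAlgebra := Subsingleton.elim _ _
  have : NumberField N := {}
  exact exists_autToPow_eq_and_pow_eq_one hcomm hζ u

/-- If `Gal(K/k)` has, modulo each open subgroup with abelian quotient, elements of order dividing
`l ^ a * (l - 1)` above every value of the mod `l` cyclotomic character, then some homomorphism to
`ℤ/p` factoring through that character does not lift to `ℤ/p²`. -/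
lemma exists_hom_not_liftable {k K : Type*} [Field k] [Field K] [Algebra k K] [IsGalois k K]
    {p l : ℕ} [Fact p.Prime] [Fact l.Prime] (hlp : l ≠ p) (hd : p ∣ l - 1)
    (hnd : ¬ p ^ 2 ∣ l - 1) {ζ : K} (hζ : IsPrimitiveRoot ζ l)
    (h : ∀ (N : IntermediateField k K) [FiniteDimensional k N] [IsGalois k N],
      (∀ a b : Gal(N/k), Commute a b) → ∀ {ξ : N} (hξ : IsPrimitiveRoot ξ l) (u : (ZMod l)ˣ),
        ∃ τ : Gal(N/k), hξ.autToPow k τ = u ∧ ∃ a, τ ^ (l ^ a * (l - 1)) = 1) :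
    ∃ φ : Gal(K/k) →* Multiplicative (ZMod p),
      IsOpen (φ.ker : Set Gal(K/k)) ∧
      ¬ ∃ φ₂ : Gal(K/k) →* Multiplicative (ZMod (p ^ 2)),
          IsOpen (φ₂.ker : Set Gal(K/k)) ∧
          ∀ g, ZMod.castHom (dvd_pow_self p two_ne_zero) (ZMod p)
              (Multiplicative.toAdd (φ₂ g)) = Multiplicative.toAdd (φ g) := by
  obtain ⟨ψ, u, hu⟩ := exists_unitsHom_ne_zero hd
  let χ : Gal(K/k) →* (ZMod l)ˣ := hζ.autToPow k
  have hχ : IsOpen (χ.ker : Set Gal(K/k)) := isOpen_ker_autToPow hζ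
  refine ⟨ψ.comp χ, Subgroup.isOpen_mono (fun g hg ↦ ?_) hχ, ?_⟩
  · rw [MonoidHom.mem_ker] at hg ⊢
    rw [MonoidHom.comp_apply, hg, map_one]
  rintro ⟨φ₂, hφ₂, hlift⟩
  let H : Subgroup Gal(K/k) := φ₂.ker ⊓ χ.ker
  have hH : IsOpen (H : Set Gal(K/k)) := hφ₂.inter hχ
  let N : IntermediateField k K := IntermediateField.fixedField H
  have hNH : N.fixingSubgroup = H :=
    InfiniteGalois.fixingSubgroup_fixedField ⟨H, Subgroup.isClosed_of_isOpen H hH⟩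
  have : FiniteDimensional k N :=
    (InfiniteGalois.isOpen_iff_finite N).mp (by rw [hNH]; exact hH)
  have : IsGalois k N :=
    (InfiniteGalois.normal_iff_isGalois N).mp (by rw [hNH]; infer_instance)
  have hker : ∀ g, AlgEquiv.restrictNormalHom N g = 1 ↔ g ∈ H := fun g ↦ by
    rw [← hNH, ← IntermediateField.restrictNormalHom_ker, MonoidHom.mem_ker]
  have hsurj : Function.Surjective (AlgEquiv.restrictNormalHom (F := k) (K₁ := K) N) :=
    AlgEquiv.restrictNormalHom_surjective _
  have hcomm : ∀ a b : Gal(N/k), Commute a b := by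
    intro a b
    obtain ⟨a, rfl⟩ := hsurj a
    obtain ⟨b, rfl⟩ := hsurj b
    rw [← commutatorElement_eq_one_iff_commute, ← map_commutatorElement, hker]
    refine Subgroup.mem_inf.mpr ⟨?_, ?_⟩ <;> rw [MonoidHom.mem_ker, map_commutatorElement,
      commutatorElement_eq_one_iff_commute] <;> exact Commute.all _ _
  have hζN : ζ ∈ N := by
    rw [IntermediateField.mem_fixedField_iff]
    intro f hf
    have hx := hζ.autToPow_spec k f
    have hf2 : hζ.autToPow k f = 1 := hf.2
    rw [← hx, hf2, Units.val_one, ZMod.val_one, pow_one]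
  have hζ' : IsPrimitiveRoot (⟨ζ, hζN⟩ : N) l :=
    .of_map_of_injective (f := N.val) hζ N.val.injective
  obtain ⟨τ, hτu, a, hτ⟩ := h N hcomm hζ' u
  obtain ⟨g, rfl⟩ := hsurj τ
  rw [← map_pow, hker] at hτ
  have hχg : χ g = u := by
    rw [hζ'.autToPow_eq_iff] at hτu
    rw [hζ.autToPow_eq_iff]
    have hx := congrArg N.val hτu
    rwa [map_pow, IntermediateField.coe_val, AlgEquiv.restrictNormalHom_apply] at hx
  have hsq := sq_dvd_of_pow_eq_one φ₂ hτ.1 (by rw [hlift, MonoidHom.comp_apply, hχg]; exact hu)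
  refine hnd (Nat.Coprime.dvd_of_dvd_mul_left ?_ hsq)
  exact ((Nat.coprime_primes (Fact.out : p.Prime) Fact.out).mpr hlp.symm).pow 2 a

lemma isGalois_separableClosure (F : Type*) [Field F] : IsGalois F (SeparableClosure F) :=
  inferInstance

theorem stmt_19 (p : ℕ) [Fact p.Prime] :
    ∃ φ : AbsGal ℚ →* Multiplicative (ZMod p),
      IsOpen (φ.ker : Set (AbsGal ℚ)) ∧
      ¬ ∃ φ₂ : AbsGal ℚ →* Multiplicative (ZMod (p ^ 2)),
          IsOpen (φ₂.ker : Set (AbsGal ℚ)) ∧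
          ∀ g, ZMod.castHom (dvd_pow_self p two_ne_zero) (ZMod p)
              (Multiplicative.toAdd (φ₂ g)) = Multiplicative.toAdd (φ g) := by
  obtain ⟨l, hl, hlp, hd, hnd⟩ := exists_prime_dvd_sub_one_not_sq_dvd p
  have : Fact l.Prime := ⟨hl⟩
  obtain ⟨ζ, hζ⟩ := HasEnoughRootsOfUnity.exists_primitiveRoot (SeparableClosure ℚ) l
  have := isGalois_separableClosure ℚ
  refine @exists_hom_not_liftable ℚ (SeparableClosure ℚ) _ _ _ this p l _ _ hlp hd hnd ζ hζ ?_
  intro N _ _ hcomm ξ hξ u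
  exact exists_autToPow_eq_and_pow_eq_one_of_finiteDimensional hcomm hξ u
end
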